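/- Let π be a set of primes with 2 ∈ π, and let G be a finite π-separable group. Let χ ∈ Irr(G) be π-factored with χ(1) a π-number. Let N be a normal subgroup of G, let θ ∈ Irr(N) be an irreducible constituent of χ_N, and let T = G_θ be the stabilizer of θ in G. If ψ ∈ Irr(T | θ) is the Clifford correspondent of χ with respect to θ, then ψ is π-factored. -/

import Mathlib

open scoped Classical

noncomputable section

/-- All prime divisors of `n` belong to the set of primes `σ`. -/
def IsPiNumber (σ : Set ℕ) (n : ℕ) : Prop :=
  ∀ q : ℕ, q.Prime → q ∣ n → q ∈ σ

/-- `g` is a `σ`-element: its order is a `σ`-number. -/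
def IsPiElt (σ : Set ℕ) {G : Type} [Group G] (g : G) : Prop :=
  IsPiNumber σ (orderOf g)

/-- The `p`-part of a natural number. -/
def pPart (p n : ℕ) : ℕ := p ^ (n.factorization p)

/-- `χ` is the character of a finite-dimensional complex representation of `G`. -/
def IsCharacter (G : Type) [Group G] (χ : G → ℂ) : Prop :=
  ∃ V : FDRep ℂ G, ∀ g, χ g = V.character g

/-- `χ` is an irreducible (ordinary, complex) character of `G`: a nonzero character
which is not the sum of two nonzero characters. -/
def IsIrrChar (G : Type) [Group G] (χ : G → ℂ) : Prop :=
  IsCharacter G χ ∧ χ ≠ 0 ∧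
    ¬ ∃ χ₁ χ₂ : G → ℂ, IsCharacter G χ₁ ∧ χ₁ ≠ 0 ∧ IsCharacter G χ₂ ∧ χ₂ ≠ 0 ∧ χ = χ₁ + χ₂

/-- Restriction of a class function on `G` to a subgroup `H`. -/
def resChar {G : Type} [Group G] (H : Subgroup G) (χ : G → ℂ) : ↥H → ℂ :=
  fun h => χ (h : G)

/-- Restriction of a class function between nested subgroups. -/
def resCharLe {G : Type} [Group G] {K H : Subgroup G} (hKH : K ≤ H) (χ : ↥H → ℂ) : ↥K → ℂ :=
  fun k => χ ⟨(k : G), hKH k.2⟩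

/-- The induced class function from a subgroup `H` of `G`, given by the usual
induction formula. -/
def indChar {G : Type} [Group G] [Fintype G] (H : Subgroup G) (ψ : ↥H → ℂ) : G → ℂ :=
  fun g => (Nat.card ↥H : ℂ)⁻¹ *
    ∑ x : G, if h : x * g * x⁻¹ ∈ H then ψ ⟨x * g * x⁻¹, h⟩ else 0

/-- Induction of a class function between nested subgroups. -/
def indCharLe {G : Type} [Group G] [Fintype G] {K H : Subgroup G} (_ : K ≤ H)
    (ψ : ↥K → ℂ) : ↥H → ℂ :=
  fun x => (Nat.card ↥K : ℂ)⁻¹ *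
    ∑ y : ↥H, if h : (y : G) * (x : G) * (y : G)⁻¹ ∈ K then ψ ⟨(y : G) * (x : G) * (y : G)⁻¹, h⟩ else 0

/-- `θ` is an irreducible constituent of the class function `χ`. -/
def IsConstituent {G : Type} [Group G] (θ χ : G → ℂ) : Prop :=
  IsIrrChar G θ ∧ ∃ ξ : G → ℂ, (ξ = 0 ∨ IsCharacter G ξ) ∧ χ = θ + ξ

/-- The restriction `χ^o` of a class function to the `σ`-elements of `G`
(extended by zero elsewhere). -/
def piRestrict (σ : Set ℕ) {G : Type} [Group G] (χ : G → ℂ) : G → ℂ :=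
  fun g => if IsPiElt σ g then χ g else 0

/-- `φ` is a `σ`-partial character of `G`: the restriction to the `σ`-elements of an
ordinary character. -/
def IsPartialChar (σ : Set ℕ) (G : Type) [Group G] (φ : G → ℂ) : Prop :=
  ∃ χ : G → ℂ, IsCharacter G χ ∧ χ ≠ 0 ∧ φ = piRestrict σ χ

/-- `φ ∈ I_σ(G)`: an irreducible `σ`-partial character, i.e. one which is not the
sum of two `σ`-partial characters. -/
def IsIPiChar (σ : Set ℕ) (G : Type) [Group G] (φ : G → ℂ) : Prop :=
  IsPartialChar σ G φ ∧
    ¬ ∃ φ₁ φ₂ : G → ℂ, IsPartialChar σ G φ₁ ∧ IsPartialChar σ G φ₂ ∧ φ = φ₁ + φ₂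

/-- `φ ∈ IBr(G)` (at the prime `p`): irreducible Brauer characters are the irreducible
`p'`-partial characters, where the `p`-regular elements are the `{p}ᶜ`-elements. -/
def IsIBrChar (p : ℕ) (G : Type) [Group G] (φ : G → ℂ) : Prop :=
  IsIPiChar ({p}ᶜ) G φ

/-- The restriction `χ^o` of `χ` to the `p`-regular elements of `G`. -/
def brRestrict (p : ℕ) {G : Type} [Group G] (χ : G → ℂ) : G → ℂ :=
  piRestrict ({p}ᶜ) χ

/-- `χ` is a lift of the `σ`-partial character `φ`. -/
def IsLiftOfPi (σ : Set ℕ) (G : Type) [Group G] (χ φ : G → ℂ) : Prop :=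
  IsIrrChar G χ ∧ piRestrict σ χ = φ

/-- `χ` is a lift: `χ` is irreducible and `χ^o` is an irreducible `σ`-partial character. -/
def IsLiftPi (σ : Set ℕ) (G : Type) [Group G] (χ : G → ℂ) : Prop :=
  IsIrrChar G χ ∧ IsIPiChar σ G (piRestrict σ χ)

/-- `H` is a subnormal subgroup of `G`. -/
def IsSubnormalSubgroup {G : Type} [Group G] (H : Subgroup G) : Prop :=
  ∃ (n : ℕ) (c : Fin (n + 1) → Subgroup G),
    c 0 = H ∧ c (Fin.last n) = ⊤ ∧
    ∀ i : Fin n, c i.castSucc ≤ c i.succ ∧ ((c i.castSucc).subgroupOf (c i.succ)).Normal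

/-- The determinantal order `o(det θ)` of `θ` is a `σ`-number. -/
def HasPiDetOrder (σ : Set ℕ) (G : Type) [Group G] (θ : G → ℂ) : Prop :=
  ∃ V : FDRep ℂ G, (∀ g, θ g = V.character g) ∧
    IsPiNumber σ (orderOf (fun g : G => LinearMap.det (V.ρ g)))

/-- `χ` is a `σ`-special character of `G`: `χ` is irreducible, `χ(1)` is a `σ`-number,
and for every subnormal subgroup `M` of `G`, every irreducible constituent of `χ_M`
has determinantal order a `σ`-number. -/
def IsPiSpecial (σ : Set ℕ) (G : Type) [Group G] (χ : G → ℂ) : Prop :=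
  IsIrrChar G χ ∧ (∃ n : ℕ, χ 1 = (n : ℂ) ∧ IsPiNumber σ n) ∧
    ∀ M : Subgroup G, IsSubnormalSubgroup M →
      ∀ θ : ↥M → ℂ, IsConstituent θ (resChar M χ) → HasPiDetOrder σ ↥M θ

/-- `χ` is `σ`-factored: `χ = αβ` with `α` `σ`-special and `β` `σ'`-special. -/
def IsPiFactored (σ : Set ℕ) (G : Type) [Group G] (χ : G → ℂ) : Prop :=
  ∃ α β : G → ℂ, IsPiSpecial σ G α ∧ IsPiSpecial σᶜ G β ∧ χ = α * β

/-- `G` is `σ`-separable: it has a subnormal series each of whose factors is a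
`σ`-group or a `σ'`-group (equivalently, every composition factor is a `σ`-group or a
`σ'`-group). -/
def IsPiSeparable (σ : Set ℕ) (G : Type) [Group G] : Prop :=
  ∃ (n : ℕ) (c : Fin (n + 1) → Subgroup G),
    c 0 = ⊥ ∧ c (Fin.last n) = ⊤ ∧
    ∀ i : Fin n, c i.castSucc ≤ c i.succ ∧ ((c i.castSucc).subgroupOf (c i.succ)).Normal ∧
      (IsPiNumber σ (Nat.card (↥(c i.succ) ⧸ (c i.castSucc).subgroupOf (c i.succ))) ∨
        IsPiNumber σᶜ (Nat.card (↥(c i.succ) ⧸ (c i.castSucc).subgroupOf (c i.succ))))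

/-- `G` is `p`-solvable: every composition factor is a `p`-group or a `p'`-group. -/
def IsPSolvable (p : ℕ) (G : Type) [Group G] : Prop :=
  IsPiSeparable {p} G

/-- The character `δ` of the subgroup `Q` is invariant under (conjugation by the
elements of) the subgroup `S`. -/
def InvariantUnder {G : Type} [Group G] (Q : Subgroup G) (δ : ↥Q → ℂ) (S : Subgroup G) : Prop :=
  ∀ g ∈ S, ∀ x : ↥Q, ∀ h : g * (x : G) * g⁻¹ ∈ Q, δ ⟨g * (x : G) * g⁻¹, h⟩ = δ x

/-- `(Q, δ)` is a vertex pair for `χ ∈ Irr(G)` (at the prime `p`): `Q` is a `p`-subgroup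
of `G`, `δ ∈ Irr(Q)`, and there are a subgroup `U ≤ G` and an irreducible character
`ψ = αβ` of `U` with `α` `p'`-special and `β` `p`-special, such that `ψ^G = χ`, `Q` is a
Sylow `p`-subgroup of `U`, and `β_Q = δ`. -/
def IsVertexPair (p : ℕ) {G : Type} [Group G] [Fintype G] (χ : G → ℂ)
    (Q : Subgroup G) (δ : ↥Q → ℂ) : Prop :=
  IsPGroup p ↥Q ∧ IsIrrChar ↥Q δ ∧
    ∃ (U : Subgroup G) (hQU : Q ≤ U) (α β : ↥U → ℂ),
      IsPiSpecial ({p}ᶜ) ↥U α ∧ IsPiSpecial {p} ↥U β ∧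
      IsIrrChar ↥U (α * β) ∧ indChar U (α * β) = χ ∧
      ¬ p ∣ (Q.subgroupOf U).index ∧
      ∀ x : ↥Q, δ x = β ⟨(x : G), hQU x.2⟩

/-- `(Q, δ)` is a generalized `σ`-vertex for `χ ∈ Irr(G)`: there are `U ≤ G` and an
irreducible `ψ = αβ ∈ Irr(U)` with `α` `σ`-special and `β` `σ'`-special such that
`ψ^G = χ`, `Q` is a Hall `σ'`-subgroup of `U` and `δ = β_Q`. -/
def IsGenPiVertex (σ : Set ℕ) {G : Type} [Group G] [Fintype G] (χ : G → ℂ)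
    (Q : Subgroup G) (δ : ↥Q → ℂ) : Prop :=
  ∃ (U : Subgroup G) (hQU : Q ≤ U) (α β : ↥U → ℂ),
    IsPiSpecial σ ↥U α ∧ IsPiSpecial σᶜ ↥U β ∧
    IsIrrChar ↥U (α * β) ∧ indChar U (α * β) = χ ∧
    IsPiNumber σᶜ (Nat.card ↥Q) ∧ IsPiNumber σ ((Q.subgroupOf U).index) ∧
    ∀ x : ↥Q, δ x = β ⟨(x : G), hQU x.2⟩

/-- The pair `(Q₂, δ₂)` is the conjugate of the pair `(Q₁, δ₁)` by the element `g`. -/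
def IsConjPair {G : Type} [Group G] (g : G)
    (Q₁ : Subgroup G) (δ₁ : ↥Q₁ → ℂ) (Q₂ : Subgroup G) (δ₂ : ↥Q₂ → ℂ) : Prop :=
  Q₂ = Subgroup.map (MulAut.conj g).toMonoidHom Q₁ ∧
    ∀ x : ↥Q₁, ∀ h : g * (x : G) * g⁻¹ ∈ Q₂, δ₂ ⟨g * (x : G) * g⁻¹, h⟩ = δ₁ x

/-- `Q` is a vertex (subgroup) of the irreducible `σ`-partial character `φ` of `G`:
`Q` is a Hall `σ'`-subgroup of a subgroup `U ≤ G` possessing an irreducible `σ`-partial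
character `κ` of `σ`-degree with `κ^G = φ`. -/
def IsVertexSubgroup (σ : Set ℕ) {G : Type} [Group G] [Fintype G] (φ : G → ℂ)
    (Q : Subgroup G) : Prop :=
  ∃ (U : Subgroup G) (κ : ↥U → ℂ), Q ≤ U ∧
    IsPiNumber σᶜ (Nat.card ↥Q) ∧ IsPiNumber σ ((Q.subgroupOf U).index) ∧
    IsIPiChar σ ↥U κ ∧ (∃ n : ℕ, κ 1 = (n : ℂ) ∧ IsPiNumber σ n) ∧
    indChar U κ = φ

/-- `θ ∈ I_σ(M)` is an irreducible constituent of the restriction `φ_M`. -/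
def IsIPiConstituent (σ : Set ℕ) {G : Type} [Group G] (M : Subgroup G)
    (θ : ↥M → ℂ) (φ : G → ℂ) : Prop :=
  IsIPiChar σ ↥M θ ∧ ∃ ξ : ↥M → ℂ, (ξ = 0 ∨ IsPartialChar σ ↥M ξ) ∧ resChar M φ = θ + ξ

section LinearAlgebra

variable {V V' : Type*} [AddCommGroup V] [Module ℂ V] [AddCommGroup V'] [Module ℂ V']

theorem det_eq_of_equiv {f : V →ₗ[ℂ] V} {f' : V' →ₗ[ℂ] V'} (e : V ≃ₗ[ℂ] V')
    (he : ∀ v, e (f v) = f' (e v)) : LinearMap.det f = LinearMap.det f' := by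
  rw [← LinearMap.det_conj f e]
  congr 1
  ext v
  simp [he]

/-- The determinant of the restriction of `f` to `U`, or `1` if `f` does not preserve `U`. -/
def detOn (f : V →ₗ[ℂ] V) (U : Submodule ℂ V) : ℂ :=
  if h : ∀ u ∈ U, f u ∈ U then LinearMap.det (f.restrict h) else 1

theorem detOn_eq {f : V →ₗ[ℂ] V} {U : Submodule ℂ V} (h : ∀ u ∈ U, f u ∈ U) :
    detOn f U = LinearMap.det (f.restrict h) := dif_pos h

theorem detOn_bot (f : V →ₗ[ℂ] V) : detOn f ⊥ = 1 := by
  have h : ∀ u ∈ (⊥ : Submodule ℂ V), f u ∈ (⊥ : Submodule ℂ V) := by simp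
  rw [detOn_eq h]
  exact LinearMap.det_eq_one_of_subsingleton _

theorem detOn_one (U : Submodule ℂ V) : detOn (1 : V →ₗ[ℂ] V) U = 1 := by
  rw [detOn_eq (fun u hu => hu)]
  exact LinearMap.det_id

theorem detOn_mul {f g : V →ₗ[ℂ] V} {U : Submodule ℂ V}
    (hf : ∀ u ∈ U, f u ∈ U) (hg : ∀ u ∈ U, g u ∈ U) :
    detOn (f * g) U = detOn f U * detOn g U := by
  rw [detOn_eq hf, detOn_eq hg,
    detOn_eq (show ∀ u ∈ U, (f * g) u ∈ U from fun u hu => hf _ (hg u hu)),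
    ← LinearMap.det_comp]
  rfl

theorem detOn_of_equiv {f : V →ₗ[ℂ] V} {f' : V' →ₗ[ℂ] V'} {U : Submodule ℂ V}
    {U' : Submodule ℂ V'} (e : U ≃ₗ[ℂ] U')
    (hf : ∀ u ∈ U, f u ∈ U) (hf' : ∀ u ∈ U', f' u ∈ U')
    (he : ∀ u : U, (e ⟨f u, hf u u.2⟩ : V') = f' (e u)) :
    detOn f U = detOn f' U' := by
  rw [detOn_eq hf, detOn_eq hf']
  exact det_eq_of_equiv e fun u => Subtype.ext (he u)

theorem detOn_top (f : V →ₗ[ℂ] V) : detOn f ⊤ = LinearMap.det f := by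
  rw [detOn_eq (fun u _ => Submodule.mem_top)]
  exact det_eq_of_equiv Submodule.topEquiv fun u => rfl

theorem detOn_sup [FiniteDimensional ℂ V] {f : V →ₗ[ℂ] V} {U₁ U₂ : Submodule ℂ V}
    (h₁ : ∀ u ∈ U₁, f u ∈ U₁) (h₂ : ∀ u ∈ U₂, f u ∈ U₂) (hd : Disjoint U₁ U₂) :
    detOn f (U₁ ⊔ U₂) = detOn f U₁ * detOn f U₂ := by
  have h : ∀ u ∈ U₁ ⊔ U₂, f u ∈ U₁ ⊔ U₂ := by
    intro u hu
    obtain ⟨a, ha, b, hb, rfl⟩ := Submodule.mem_sup.1 hu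
    rw [map_add]
    exact Submodule.add_mem_sup (h₁ a ha) (h₂ b hb)
  rw [detOn_eq h, detOn_eq h₁, detOn_eq h₂, ← LinearMap.det_prodMap]
  let φ : (U₁ × U₂) →ₗ[ℂ] ↥(U₁ ⊔ U₂) :=
    (Submodule.inclusion le_sup_left).coprod (Submodule.inclusion le_sup_right)
  have hφ : Function.Bijective φ := by
    constructor
    · rw [← LinearMap.ker_eq_bot, LinearMap.ker_eq_bot']
      rintro ⟨a, b⟩ hab
      have hab' : (a : V) + b = 0 := by simpa [φ] using congrArg Subtype.val hab
      have ha : (a : V) ∈ U₂ := by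
        rw [eq_neg_of_add_eq_zero_left hab']; exact U₂.neg_mem b.2
      have ha0 : (a : V) = 0 := by
        simpa using (Submodule.disjoint_def.1 hd) a a.2 ha
      have hb0 : (b : V) = 0 := by simpa [ha0] using hab'
      ext <;> simp [ha0, hb0]
    · rintro ⟨u, hu⟩
      obtain ⟨a, ha, b, hb, rfl⟩ := Submodule.mem_sup.1 hu
      exact ⟨(⟨a, ha⟩, ⟨b, hb⟩), by ext; simp [φ]⟩
  refine (det_eq_of_equiv (LinearEquiv.ofBijective φ hφ) ?_).symm
  rintro ⟨a, b⟩
  ext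
  simp [φ, LinearMap.restrict_apply]

end LinearAlgebra

section PiNumber

theorem IsPiNumber.mul {σ : Set ℕ} {m n : ℕ} (hm : IsPiNumber σ m) (hn : IsPiNumber σ n) :
    IsPiNumber σ (m * n) := fun q hq h =>
  ((Nat.Prime.dvd_mul hq).1 h).elim (hm q hq) (hn q hq)

theorem IsPiNumber.of_dvd {σ : Set ℕ} {m n : ℕ} (hn : IsPiNumber σ n) (h : m ∣ n) :
    IsPiNumber σ m := fun q hq hqm => hn q hq (hqm.trans h)

theorem isPiNumber_one (σ : Set ℕ) : IsPiNumber σ 1 := fun _ hq h =>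
  absurd (Nat.dvd_one.1 h) hq.ne_one

theorem IsPiNumber.coprime {σ : Set ℕ} {m n : ℕ} (hm : IsPiNumber σ m) (hn : IsPiNumber σᶜ n) :
    m.Coprime n :=
  Nat.coprime_of_dvd fun q hq hqm hqn => hn q hq hqn (hm q hq hqm)

/-- `z` is a root of unity whose order is a `σ`-number. -/
def IsPiRoot (σ : Set ℕ) (z : ℂ) : Prop := ∃ n : ℕ, n ≠ 0 ∧ IsPiNumber σ n ∧ z ^ n = 1

variable {σ : Set ℕ} {z w : ℂ}

theorem isPiRoot_one (σ : Set ℕ) : IsPiRoot σ 1 := ⟨1, one_ne_zero, isPiNumber_one σ, by simp⟩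

theorem IsPiRoot.mul (hz : IsPiRoot σ z) (hw : IsPiRoot σ w) : IsPiRoot σ (z * w) := by
  obtain ⟨m, hm0, hm, h1⟩ := hz
  obtain ⟨n, hn0, hn, h2⟩ := hw
  refine ⟨m * n, mul_ne_zero hm0 hn0, hm.mul hn, ?_⟩
  rw [mul_pow, pow_mul, h1, mul_comm m n, pow_mul, h2]; simp

theorem IsPiRoot.inv (hz : IsPiRoot σ z) : IsPiRoot σ z⁻¹ := by
  obtain ⟨m, hm0, hm, h1⟩ := hz
  exact ⟨m, hm0, hm, by rw [inv_pow, h1, inv_one]⟩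

theorem IsPiRoot.ne_zero (hz : IsPiRoot σ z) : z ≠ 0 := by
  obtain ⟨m, hm0, -, h1⟩ := hz
  rintro rfl
  rw [zero_pow hm0] at h1
  exact zero_ne_one h1

theorem IsPiRoot.of_pow {k : ℕ} (hk0 : k ≠ 0) (hk : IsPiNumber σ k) (h : IsPiRoot σ (z ^ k)) :
    IsPiRoot σ z := by
  obtain ⟨m, hm0, hm, h1⟩ := h
  exact ⟨k * m, mul_ne_zero hk0 hm0, hk.mul hm, by rw [pow_mul, h1]⟩

theorem IsPiRoot.of_mul_right (hw : IsPiRoot σ w) (h : IsPiRoot σ (z * w)) : IsPiRoot σ z := by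
  simpa [mul_assoc, hw.ne_zero] using h.mul hw.inv

theorem IsPiRoot.prod {ι : Type*} (s : Finset ι) (f : ι → ℂ) (h : ∀ i ∈ s, IsPiRoot σ (f i)) :
    IsPiRoot σ (∏ i ∈ s, f i) :=
  Finset.prod_induction f (IsPiRoot σ) (fun _ _ => IsPiRoot.mul) (isPiRoot_one σ) h

end PiNumber

section InvariantSubspaces

variable {G : Type} [Group G] {V : Type} [AddCommGroup V] [Module ℂ V]

/-- The subspace `U` is invariant under the subgroup `M`. -/
def InvOn (ρ : Representation ℂ G V) (M : Subgroup G) (U : Submodule ℂ V) : Prop :=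
  ∀ g ∈ M, ∀ u ∈ U, ρ g u ∈ U

/-- The subspace `U` is an irreducible representation of the subgroup `M`. -/
def IrrOn (ρ : Representation ℂ G V) (M : Subgroup G) (U : Submodule ℂ V) : Prop :=
  InvOn ρ M U ∧ U ≠ ⊥ ∧ ∀ U' ≤ U, InvOn ρ M U' → U' ≠ ⊥ → U' = U

/-- The endomorphism `p` commutes with the action of the subgroup `M`. -/
def EquivariantOn (ρ : Representation ℂ G V) (M : Subgroup G) (p : V →ₗ[ℂ] V) : Prop :=
  ∀ g ∈ M, ∀ v, p (ρ g v) = ρ g (p v)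

variable {ρ : Representation ℂ G V} {M M' : Subgroup G} {U U' W : Submodule ℂ V}
  {p : V →ₗ[ℂ] V}

theorem rho_inv_apply_apply (g : G) (v : V) : ρ g⁻¹ (ρ g v) = v := by
  rw [← Module.End.mul_apply, ← map_mul]; simp

theorem rho_apply_inv_apply (g : G) (v : V) : ρ g (ρ g⁻¹ v) = v := by
  rw [← Module.End.mul_apply, ← map_mul]; simp

theorem InvOn.mono (h : InvOn ρ M' U) (hM : M ≤ M') : InvOn ρ M U :=
  fun g hg => h g (hM hg)

theorem InvOn.inf (h : InvOn ρ M U) (h' : InvOn ρ M U') : InvOn ρ M (U ⊓ U') :=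
  fun g hg u hu => ⟨h g hg u hu.1, h' g hg u hu.2⟩

theorem InvOn.sup (h : InvOn ρ M U) (h' : InvOn ρ M U') : InvOn ρ M (U ⊔ U') := by
  intro g hg u hu
  obtain ⟨a, ha, b, hb, rfl⟩ := Submodule.mem_sup.1 hu
  rw [map_add]
  exact Submodule.add_mem_sup (h g hg a ha) (h' g hg b hb)

theorem invOn_bot : InvOn ρ M ⊥ := by
  intro g _ u hu
  simp_all

theorem invOn_top : InvOn ρ M ⊤ := fun _ _ _ _ => Submodule.mem_top

theorem EquivariantOn.mono (h : EquivariantOn ρ M' p) (hM : M ≤ M') : EquivariantOn ρ M p :=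
  fun g hg => h g (hM hg)

theorem EquivariantOn.invOn_ker (h : EquivariantOn ρ M p) : InvOn ρ M (LinearMap.ker p) := by
  intro g hg u hu
  rw [LinearMap.mem_ker] at hu ⊢
  rw [h g hg, hu, map_zero]

theorem InvOn.map (h : InvOn ρ M U) (hp : EquivariantOn ρ M p) : InvOn ρ M (U.map p) := by
  rintro g hg _ ⟨u, hu, rfl⟩
  exact ⟨ρ g u, h g hg u hu, hp g hg u⟩

theorem InvOn.comap (h : InvOn ρ M U) (hp : EquivariantOn ρ M p) : InvOn ρ M (U.comap p) := by
  intro g hg u hu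
  rw [Submodule.mem_comap] at hu ⊢
  rw [hp g hg]
  exact h g hg _ hu

/-- A nonzero equivariant map is injective on an irreducible subspace. -/
theorem IrrOn.injOn (h : IrrOn ρ M U) (hp : EquivariantOn ρ M p) {u : V} (hu : u ∈ U)
    (hpu : p u ≠ 0) : ∀ v ∈ U, p v = 0 → v = 0 := by
  intro v hv hpv
  by_contra hv0
  have hne : U ⊓ LinearMap.ker p ≠ ⊥ := fun hbot =>
    hv0 ((Submodule.mem_bot ℂ).1 (hbot ▸ Submodule.mem_inf.2 ⟨hv, LinearMap.mem_ker.2 hpv⟩))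
  have := h.2.2 _ inf_le_left (h.1.inf hp.invOn_ker) hne
  rw [← this] at hu
  exact hpu hu.2

theorem IrrOn.map (h : IrrOn ρ M U) (hp : EquivariantOn ρ M p) (hinj : ∀ v ∈ U, p v = 0 → v = 0) :
    IrrOn ρ M (U.map p) := by
  refine ⟨h.1.map hp, ?_, ?_⟩
  · intro hbot
    apply h.2.1
    rw [eq_bot_iff]
    intro v hv
    exact hinj v hv ((Submodule.mem_bot ℂ).1 (hbot ▸ ⟨v, hv, rfl⟩))
  · intro U' hU' hinv hne
    have h1 : U ⊓ U'.comap p = U := by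
      refine h.2.2 _ inf_le_left (h.1.inf (hinv.comap hp)) fun hbot => hne ?_
      rw [eq_bot_iff]
      intro y hy
      obtain ⟨u, hu, rfl⟩ := hU' hy
      have : u ∈ U ⊓ U'.comap p := ⟨hu, hy⟩
      rw [hbot, Submodule.mem_bot] at this
      simp [this]
    refine le_antisymm hU' ?_
    rintro _ ⟨u, hu, rfl⟩
    have hu' : u ∈ U ⊓ U'.comap p := h1.symm ▸ hu
    exact hu'.2

/-- The equivalence onto the image under a map injective on `U`. -/
def equivMapOfInjOn (p : V →ₗ[ℂ] V) (U : Submodule ℂ V) (hinj : ∀ v ∈ U, p v = 0 → v = 0) :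
    U ≃ₗ[ℂ] U.map p :=
  LinearEquiv.ofBijective
    (p.restrict (p := U) (q := U.map p) fun u hu => Submodule.mem_map_of_mem hu) <| by
    constructor
    · rw [← LinearMap.ker_eq_bot, LinearMap.ker_eq_bot']
      rintro ⟨v, hv⟩ h
      have := congrArg Subtype.val h
      exact Subtype.ext (hinj v hv (by simpa using this))
    · rintro ⟨_, u, hu, rfl⟩
      exact ⟨⟨u, hu⟩, rfl⟩

theorem equivMapOfInjOn_apply (hinj : ∀ v ∈ U, p v = 0 → v = 0) (u : U) :
    (equivMapOfInjOn p U hinj u : V) = p u := rfl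

theorem finrank_map_of_injOn (hinj : ∀ v ∈ U, p v = 0 → v = 0) :
    Module.finrank ℂ (U.map p) = Module.finrank ℂ U :=
  (equivMapOfInjOn p U hinj).finrank_eq.symm

theorem detOn_map_of_injOn (h : InvOn ρ M U) (hp : EquivariantOn ρ M p)
    (hinj : ∀ v ∈ U, p v = 0 → v = 0) {m : G} (hm : m ∈ M) :
    detOn (ρ m) (U.map p) = detOn (ρ m) U :=
  (detOn_of_equiv (equivMapOfInjOn p U hinj) (h m hm) (h.map hp m hm) fun u => hp m hm u).symm

theorem rho_injOn (g : G) (U : Submodule ℂ V) : ∀ v ∈ U, ρ g v = 0 → v = 0 := by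
  intro v _ hv
  rw [← rho_inv_apply_apply (ρ := ρ) g v, hv, map_zero]

theorem finrank_translate (g : G) (U : Submodule ℂ V) :
    Module.finrank ℂ (U.map (ρ g)) = Module.finrank ℂ U :=
  finrank_map_of_injOn (rho_injOn g U)

theorem map_rho_inv_map_rho (g : G) (U : Submodule ℂ V) : (U.map (ρ g)).map (ρ g⁻¹) = U := by
  rw [← Submodule.map_comp]
  convert Submodule.map_id U
  ext v
  exact rho_inv_apply_apply g v

theorem InvOn.translate {g : G} (hg : ∀ m ∈ M, g⁻¹ * m * g ∈ M) (h : InvOn ρ M U) :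
    InvOn ρ M (U.map (ρ g)) := by
  rintro m hm _ ⟨u, hu, rfl⟩
  refine ⟨ρ (g⁻¹ * m * g) u, h _ (hg m hm) u hu, ?_⟩
  rw [← Module.End.mul_apply, ← Module.End.mul_apply, ← map_mul, ← map_mul]
  congr 2
  group

theorem IrrOn.translate {g : G} (hg : ∀ m ∈ M, g⁻¹ * m * g ∈ M) (hg' : ∀ m ∈ M, g * m * g⁻¹ ∈ M)
    (h : IrrOn ρ M U) : IrrOn ρ M (U.map (ρ g)) := by
  refine ⟨h.1.translate hg, fun hbot => h.2.1 ?_, fun U' hU' hinv hne => ?_⟩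
  · rw [← map_rho_inv_map_rho (ρ := ρ) g U, hbot, Submodule.map_bot]
  · have h1 : U'.map (ρ g⁻¹) = U := by
      refine h.2.2 _ ?_ (hinv.translate (by simpa using hg')) fun hbot => hne ?_
      · rw [← map_rho_inv_map_rho (ρ := ρ) g U]
        exact Submodule.map_mono hU'
      · have := map_rho_inv_map_rho (ρ := ρ) g⁻¹ U'
        rw [← this, hbot, Submodule.map_bot]
    have := map_rho_inv_map_rho (ρ := ρ) g⁻¹ U'
    rw [inv_inv, h1] at this
    exact this.symm

theorem detOn_translate {g : G} (hg : ∀ m ∈ M, g⁻¹ * m * g ∈ M) (h : InvOn ρ M U) {m : G}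
    (hm : m ∈ M) : detOn (ρ m) (U.map (ρ g)) = detOn (ρ (g⁻¹ * m * g)) U := by
  refine (detOn_of_equiv (equivMapOfInjOn (ρ g) U (rho_injOn g U)) (h _ (hg m hm))
    (h.translate hg m hm) fun u => ?_).symm
  rw [equivMapOfInjOn_apply, equivMapOfInjOn_apply, ← Module.End.mul_apply,
    ← Module.End.mul_apply, ← map_mul, ← map_mul]
  congr 2
  group

/-- The sum of the translates of `U` by the elements of `M`. -/
def translates (ρ : Representation ℂ G V) (M : Subgroup G) (U : Submodule ℂ V) :
    Submodule ℂ V := ⨆ g : M, U.map (ρ g)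

theorem invOn_translates : InvOn ρ M (translates ρ M U) := by
  intro g hg
  have : (translates ρ M U) ≤ (translates ρ M U).comap (ρ g) := by
    refine iSup_le fun x => ?_
    rintro _ ⟨u, hu, rfl⟩
    refine (le_iSup (fun x : M => U.map (ρ x)) (⟨g, hg⟩ * x)) ⟨u, hu, ?_⟩
    simp
  exact this

theorem le_translates : U ≤ translates ρ M U := by
  refine le_trans ?_ (le_iSup (fun x : M => U.map (ρ x)) 1)
  intro u hu
  exact ⟨u, hu, by simp⟩

theorem translates_le (hW : InvOn ρ M W) (h : U ≤ W) : translates ρ M U ≤ W := by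
  refine iSup_le fun x => ?_
  rintro _ ⟨u, hu, rfl⟩
  exact hW x x.2 u (h hu)

theorem IrrOn.translates_eq (hW : IrrOn ρ M W) (h : U ≤ W) (hU : U ≠ ⊥) :
    translates ρ M U = W :=
  hW.2.2 _ (translates_le hW.1 h) invOn_translates fun hbot =>
    hU (eq_bot_iff.2 (hbot ▸ le_translates))

variable [Finite G]

/-- Maschke's theorem: every invariant subspace is the image of an equivariant projection. -/
theorem InvOn.exists_proj (hU : InvOn ρ M U) :
    ∃ p : V →ₗ[ℂ] V, EquivariantOn ρ M p ∧ (∀ v, p v ∈ U) ∧ ∀ u ∈ U, p u = u := by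
  have : Fintype M := Fintype.ofFinite M
  obtain ⟨q, hq⟩ := U.subtype.exists_leftInverse_of_injective U.ker_subtype
  have hq' : ∀ u (hu : u ∈ U), (q u : V) = u := fun u hu =>
    congrArg Subtype.val (LinearMap.congr_fun hq ⟨u, hu⟩)
  have hc : (Fintype.card M : ℂ) ≠ 0 := Nat.cast_ne_zero.2 Fintype.card_ne_zero
  refine ⟨(Fintype.card M : ℂ)⁻¹ • ∑ m : M, ρ m ∘ₗ U.subtype ∘ₗ q ∘ₗ ρ (m : G)⁻¹, ?_, ?_, ?_⟩
  · intro g hg v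
    simp only [LinearMap.smul_apply, LinearMap.sum_apply, LinearMap.comp_apply, map_smul, map_sum]
    congr 1
    refine Fintype.sum_equiv (Equiv.mulLeft (⟨g, hg⟩⁻¹ : M)) _ _ fun m => ?_
    simp only [Equiv.coe_mulLeft, Subgroup.coe_mul, mul_inv_rev, map_mul, Module.End.mul_apply,
      InvMemClass.coe_inv, inv_inv, rho_apply_inv_apply]
  · intro v
    simp only [LinearMap.smul_apply, LinearMap.sum_apply]
    exact U.smul_mem _ (U.sum_mem fun m _ => hU m m.2 _ (q _).2)
  · intro u hu
    have : ∀ m : M, (ρ m ∘ₗ U.subtype ∘ₗ q ∘ₗ ρ (m : G)⁻¹) u = u := by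
      intro m
      simp only [LinearMap.comp_apply, Submodule.subtype_apply]
      rw [hq' _ (hU _ (M.inv_mem m.2) u hu), rho_apply_inv_apply]
    simp only [LinearMap.smul_apply, LinearMap.sum_apply, this]
    rw [Finset.sum_const, Finset.card_univ, ← Nat.cast_smul_eq_nsmul ℂ, smul_smul,
      inv_mul_cancel₀ hc, one_smul]

theorem InvOn.exists_compl (hU : InvOn ρ M U) (hU' : InvOn ρ M U') (h : U' ≤ U) :
    ∃ C ≤ U, InvOn ρ M C ∧ Disjoint U' C ∧ U' ⊔ C = U := by
  obtain ⟨p, hp, hpU, hpid⟩ := hU'.exists_proj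
  refine ⟨U ⊓ LinearMap.ker p, inf_le_left, hU.inf hp.invOn_ker, ?_, ?_⟩
  · rw [Submodule.disjoint_def]
    intro x hx hx'
    rw [← hpid x hx, LinearMap.mem_ker.1 hx'.2]
  · refine le_antisymm (sup_le h inf_le_left) fun u hu => ?_
    refine Submodule.mem_sup.2 ⟨p u, hpU u, u - p u, ⟨U.sub_mem hu (h (hpU u)), ?_⟩, by simp⟩
    change p (u - p u) = 0
    rw [map_sub, hpid _ (hpU u), sub_self]

variable [FiniteDimensional ℂ V]

omit [Finite G] in
theorem InvOn.exists_irrOn (hU : InvOn ρ M U) (hne : U ≠ ⊥) : ∃ A ≤ U, IrrOn ρ M A := by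
  induction h : Module.finrank ℂ U using Nat.strong_induction_on generalizing U with
  | _ n ih =>
    by_cases hirr : IrrOn ρ M U
    · exact ⟨U, le_rfl, hirr⟩
    · simp only [IrrOn, not_and, not_forall] at hirr
      obtain ⟨U', hle, hinv, hne', hneq⟩ := hirr hU hne
      have hlt := Submodule.finrank_lt_finrank_of_lt (lt_of_le_of_ne hle hneq)
      obtain ⟨A, hA, hA'⟩ := ih _ (h ▸ hlt) hinv hne' rfl
      exact ⟨A, hA.trans hle, hA'⟩

/-- Induction on invariant subspaces by splitting off irreducible ones. -/
theorem InvOn.induction {P : Submodule ℂ V → Prop} (hbot : P ⊥)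
    (hsup : ∀ A B, IrrOn ρ M A → A ≤ W → InvOn ρ M B → B ≤ W → Disjoint A B → P B → P (A ⊔ B))
    (hU : InvOn ρ M U) (hUW : U ≤ W) : P U := by
  induction h : Module.finrank ℂ U using Nat.strong_induction_on generalizing U with
  | _ n ih =>
    by_cases hne : U = ⊥
    · exact hne ▸ hbot
    · obtain ⟨A, hA, hirr⟩ := hU.exists_irrOn hne
      obtain ⟨C, hC, hCinv, hdisj, hAC⟩ := hU.exists_compl hirr.1 hA
      have hlt : C < U := lt_of_le_of_ne hC fun hCU => by
        rw [hCU] at hdisj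
        exact hirr.2.1 (disjoint_self.1 (hdisj.mono_right hA))
      rw [← hAC]
      exact hsup A C hirr (hA.trans hUW) hCinv (hC.trans hUW) hdisj
        (ih _ (h ▸ Submodule.finrank_lt_finrank_of_lt hlt) hCinv (hC.trans hUW) rfl)

/-- An `M`-irreducible subspace of an `M'`-invariant subspace `W` embeds into an `M'`-irreducible
subspace of `W`. -/
theorem IrrOn.exists_irrOn_over (hM : M ≤ M') (hW : InvOn ρ M' W) (hU : IrrOn ρ M U)
    (hUW : U ≤ W) : ∃ Y ≤ W, IrrOn ρ M' Y ∧ ∃ p : V →ₗ[ℂ] V, EquivariantOn ρ M' p ∧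
      U.map p ≤ Y ∧ ∀ u ∈ U, p u = 0 → u = 0 := by
  have hTW := translates_le hW hUW
  obtain ⟨Y, hY, hYirr⟩ := (invOn_translates (ρ := ρ) (M := M') (U := U)).exists_irrOn
    fun hbot => hU.2.1 (eq_bot_iff.2 (hbot ▸ le_translates))
  obtain ⟨p, hp, hpY, hpid⟩ := hYirr.1.exists_proj
  refine ⟨Y, hY.trans hTW, hYirr, p, hp, ?_, ?_⟩
  · rintro _ ⟨u, -, rfl⟩
    exact hpY u
  · obtain ⟨u, hu, hpu⟩ : ∃ u ∈ U, p u ≠ 0 := by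
      by_contra! hcon
      have : translates ρ M' U ≤ LinearMap.ker p := translates_le hp.invOn_ker hcon
      refine hYirr.2.1 (eq_bot_iff.2 fun y hy => ?_)
      rw [Submodule.mem_bot, ← hpid y hy, LinearMap.mem_ker.1 (this (hY hy))]
    exact hU.injOn (hp.mono hM) hu hpu

omit [Finite G] in
theorem exists_finrank_detOn_sup {ι : Type*} (σ : Set ℕ) (s : Finset ι) (F : ι → Submodule ℂ V)
    (r : ℕ) (hF : ∀ i ∈ s, IrrOn ρ M (F i)) (hr : ∀ i ∈ s, Module.finrank ℂ (F i) = r) {m : G}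
    (hm : m ∈ M) (d : ℂ) (hd : ∀ i ∈ s, ∃ z, IsPiRoot σ z ∧ detOn (ρ m) (F i) = d * z) :
    InvOn ρ M (s.sup F) ∧ ∃ k z, Module.finrank ℂ ↥(s.sup F) = k * r ∧ IsPiRoot σ z ∧
      detOn (ρ m) (s.sup F) = d ^ k * z := by
  induction s using Finset.induction_on with
  | empty => exact ⟨invOn_bot, 0, 1, by simp, isPiRoot_one σ, by simp [detOn_bot]⟩
  | insert j s hj ih =>
    obtain ⟨hinv, k, z, hk, hz, hdet⟩ := ih (fun i hi => hF i (Finset.mem_insert_of_mem hi))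
      (fun i hi => hr i (Finset.mem_insert_of_mem hi))
      (fun i hi => hd i (Finset.mem_insert_of_mem hi))
    have hirr := hF j (Finset.mem_insert_self j s)
    rw [Finset.sup_insert]
    refine ⟨hirr.1.sup hinv, ?_⟩
    by_cases hb : F j ⊓ s.sup F = ⊥
    · obtain ⟨w, hw, hwd⟩ := hd j (Finset.mem_insert_self j s)
      refine ⟨k + 1, z * w, ?_, hz.mul hw, ?_⟩
      · have := Submodule.finrank_sup_add_finrank_inf_eq (F j) (s.sup F)
        rw [hb, finrank_bot, hk, hr j (Finset.mem_insert_self j s)] at this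
        linarith
      · rw [detOn_sup (hirr.1 m hm) (hinv m hm) (disjoint_iff.2 hb), hdet, hwd]
        ring
    · have := hirr.2.2 _ inf_le_left (hirr.1.inf hinv) hb
      rw [sup_eq_right.2 (inf_eq_left.1 this)]
      exact ⟨k, z, hk, hz, hdet⟩

/-- The dimension of an irreducible constituent of the restriction to a normal subgroup divides
the dimension. -/
theorem IrrOn.finrank_dvd (hn : ∀ g ∈ M', ∀ m ∈ M, g * m * g⁻¹ ∈ M) {Y : Submodule ℂ V}
    (hY : IrrOn ρ M' Y) (hU : IrrOn ρ M U) (hUY : U ≤ Y) :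
    Module.finrank ℂ U ∣ Module.finrank ℂ Y := by
  have : Fintype M' := Fintype.ofFinite M'
  have hn' : ∀ g ∈ M', ∀ m ∈ M, g⁻¹ * m * g ∈ M := fun g hg m hm => by
    simpa using hn g⁻¹ (M'.inv_mem hg) m hm
  rw [← hY.translates_eq hUY hU.2.1, translates, ← Finset.sup_univ_eq_iSup]
  obtain ⟨-, k, -, hk, -⟩ := exists_finrank_detOn_sup (ρ := ρ) (M := M) (∅ : Set ℕ) Finset.univ
    (fun x : M' => U.map (ρ x)) (Module.finrank ℂ U)
    (fun x _ => hU.translate (hn' x x.2) (hn x x.2)) (fun x _ => finrank_translate _ U)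
    M.one_mem 1 (fun x _ => ⟨1, isPiRoot_one _, by simp [detOn_one]⟩)
  exact ⟨k, by rw [hk, mul_comm]⟩

/-- If the conjugation action on the determinant of `U` is trivial up to roots of unity of
`σ`-order, then the determinant of `U` is controlled by that of the span of its translates. -/
theorem IrrOn.isPiRoot_detOn {σ : Set ℕ} {X : Subgroup G}
    (hn : ∀ g ∈ X, ∀ m ∈ M, g * m * g⁻¹ ∈ M) {Y : Submodule ℂ V}
    (hY : IrrOn ρ X Y) (hU : IrrOn ρ M U) (hUY : U ≤ Y) (hdeg : IsPiNumber σ (Module.finrank ℂ Y))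
    {m : G} (hm : m ∈ M)
    (hcomm : ∀ x ∈ X, IsPiRoot σ (detOn (ρ (m⁻¹ * (x⁻¹ * m * x))) U))
    (hdet : IsPiRoot σ (detOn (ρ m) Y)) : IsPiRoot σ (detOn (ρ m) U) := by
  have : Fintype X := Fintype.ofFinite X
  have hn' : ∀ g ∈ X, ∀ m ∈ M, g⁻¹ * m * g ∈ M := fun g hg m hm => by
    simpa using hn g⁻¹ (X.inv_mem hg) m hm
  obtain ⟨-, k, z, hk, hz, hd⟩ := exists_finrank_detOn_sup (ρ := ρ) (M := M) σ Finset.univ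
    (fun x : X => U.map (ρ x)) (Module.finrank ℂ U)
    (fun x _ => hU.translate (hn' x x.2) (hn x x.2)) (fun x _ => finrank_translate _ U)
    hm (detOn (ρ m) U) (fun x _ => ⟨_, hcomm x x.2, by
      rw [detOn_translate (hn' x x.2) hU.1 hm, ← detOn_mul (hU.1 m hm)
        (hU.1 _ (M.mul_mem (M.inv_mem hm) (hn' x x.2 m hm))), ← map_mul, mul_inv_cancel_left]⟩)
  rw [Finset.sup_univ_eq_iSup] at hk hd
  change Module.finrank ℂ (translates ρ X U) = _ at hk
  change detOn _ (translates ρ X U) = _ at hd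
  rw [hY.translates_eq hUY hU.2.1] at hk hd
  have hY0 : Module.finrank ℂ Y ≠ 0 := fun h0 => hY.2.1 (Submodule.finrank_eq_zero.1 h0)
  refine IsPiRoot.of_pow (k := k) ?_ (hdeg.of_dvd ⟨_, hk⟩) (hz.of_mul_right (hd ▸ hdet))
  rintro rfl
  exact hY0 (by simpa using hk)

end InvariantSubspaces

section Subnormal

variable {G : Type} [Group G] {M H K L X : Subgroup G}

/-- `M` is a subgroup of `L` normalized by `L`. -/
def NormalIn (M L : Subgroup G) : Prop := M ≤ L ∧ ∀ g ∈ L, ∀ m ∈ M, g * m * g⁻¹ ∈ M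

/-- `SubnormalIn M K`: the subgroup `M` is subnormal in the subgroup `K`. -/
inductive SubnormalIn : Subgroup G → Subgroup G → Prop
  | refl (K : Subgroup G) : SubnormalIn K K
  | step {M L K : Subgroup G} (h : NormalIn M L) (h' : SubnormalIn L K) : SubnormalIn M K

theorem NormalIn.inf (h : NormalIn M L) (X : Subgroup G) : NormalIn (M ⊓ X) (L ⊓ X) :=
  ⟨inf_le_inf_right X h.1, fun g hg m hm =>
    ⟨h.2 g hg.1 m hm.1, X.mul_mem (X.mul_mem hg.2 hm.2) (X.inv_mem hg.2)⟩⟩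

theorem NormalIn.inv_mul_mul (h : NormalIn M L) {g m : G} (hg : g ∈ L) (hm : m ∈ M) :
    g⁻¹ * m * g ∈ M := by
  simpa using h.2 g⁻¹ (L.inv_mem hg) m hm

theorem NormalIn.subgroupOf_normal (h : NormalIn M L) : (M.subgroupOf L).Normal :=
  ⟨fun m hm g => by
    rw [Subgroup.mem_subgroupOf] at hm ⊢
    exact h.2 g g.2 m hm⟩

theorem normalIn_of_subgroupOf (hle : M ≤ L) (h : (M.subgroupOf L).Normal) : NormalIn M L :=
  ⟨hle, fun g hg m hm => by
    have := h.conj_mem ⟨m, hle hm⟩ (Subgroup.mem_subgroupOf.2 hm) ⟨g, hg⟩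
    simpa [Subgroup.mem_subgroupOf] using this⟩

theorem SubnormalIn.le (h : SubnormalIn M K) : M ≤ K := by
  induction h with
  | refl => exact le_rfl
  | step h _ ih => exact h.1.trans ih

theorem NormalIn.subnormalIn (h : NormalIn M K) : SubnormalIn M K := .step h (.refl K)

theorem SubnormalIn.trans (h : SubnormalIn M L) (h' : SubnormalIn L K) : SubnormalIn M K := by
  induction h with
  | refl => exact h'
  | step h _ ih => exact .step h (ih h')

theorem SubnormalIn.inf (h : SubnormalIn M H) (X : Subgroup G) : SubnormalIn (M ⊓ X) (H ⊓ X) := by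
  induction h with
  | refl => exact .refl _
  | step h _ ih => exact .step (h.inf X) ih

theorem NormalIn.map {G' : Type} [Group G'] (f : G →* G') (h : NormalIn M L) :
    NormalIn (M.map f) (L.map f) := by
  refine ⟨Subgroup.map_mono h.1, ?_⟩
  rintro _ ⟨g, hg, rfl⟩ _ ⟨m, hm, rfl⟩
  exact ⟨g * m * g⁻¹, h.2 g hg m hm, by simp⟩

theorem SubnormalIn.map {G' : Type} [Group G'] (f : G →* G') (h : SubnormalIn M L) :
    SubnormalIn (M.map f) (L.map f) := by
  induction h with
  | refl => exact .refl _
  | step h _ ih => exact .step (h.map f) ih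

theorem isSubnormalSubgroup_iff : IsSubnormalSubgroup M ↔ SubnormalIn M ⊤ := by
  constructor
  · rintro ⟨n, c, rfl, hlast, hc⟩
    have : ∀ i, SubnormalIn (c i) ⊤ := by
      intro i
      induction i using Fin.reverseInduction with
      | last => exact hlast ▸ .refl _
      | cast i ih => exact .step (normalIn_of_subgroupOf (hc i).1 (hc i).2) ih
    exact this 0
  · intro h
    generalize hK : (⊤ : Subgroup G) = K at h
    induction h with
    | refl => exact ⟨0, fun _ => ⊤, hK, rfl, fun i => i.elim0⟩
    | @step M L K h _ ih =>
      obtain ⟨n, c, h0, hlast, hc⟩ := ih hK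
      refine ⟨n + 1, Fin.cons M c, rfl, ?_, fun i => ?_⟩
      · rw [← Fin.succ_last, Fin.cons_succ, hlast]
      · induction i using Fin.cases with
        | zero =>
          rw [Fin.castSucc_zero, Fin.cons_zero, Fin.cons_succ, h0]
          exact ⟨h.1, h.subgroupOf_normal⟩
        | succ i =>
          rw [Fin.cons_succ, ← Fin.succ_castSucc, Fin.cons_succ]
          exact hc i

theorem NormalIn.relIndex_sup (h : NormalIn K L) (hX : X ≤ L) :
    K.relIndex (X ⊔ K) = K.relIndex X := by
  have := h.subgroupOf_normal
  rw [← Subgroup.relIndex_subgroupOf (H := K) (sup_le hX h.1), Subgroup.subgroupOf_sup hX h.1,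
    Subgroup.relIndex_sup_right, Subgroup.relIndex_subgroupOf hX]

theorem NormalIn.sup_normal {N : Subgroup G} [hN : N.Normal] (h : NormalIn K L) :
    NormalIn (N ⊔ K) (N ⊔ L) := by
  refine ⟨sup_le_sup_left h.1 N, fun g hg m hm => ?_⟩
  have hle : N ⊔ L ≤ Subgroup.normalizer ((N ⊔ K : Subgroup G) : Set G) := by
    refine sup_le (le_sup_left.trans Subgroup.le_normalizer) fun l hl => ?_
    rw [Subgroup.mem_normalizer_iff]
    have key : ∀ l ∈ L, ∀ x ∈ N ⊔ K, l * x * l⁻¹ ∈ N ⊔ K := by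
      intro l hl x hx
      obtain ⟨a, ha, b, hb, rfl⟩ := Subgroup.mem_sup_of_normal_left.1 hx
      have e : l * (a * b) * l⁻¹ = l * a * l⁻¹ * (l * b * l⁻¹) := by group
      rw [e]
      exact Subgroup.mul_mem_sup (hN.conj_mem a ha l) (h.2 l hl b hb)
    refine fun x => ⟨key l hl x, fun hx => ?_⟩
    have := key l⁻¹ (L.inv_mem hl) _ hx
    convert this using 1
    group
  exact (Subgroup.mem_normalizer_iff.1 (hle hg) m).1 hm

/-- Induction along a `π`-series above a normal subgroup. -/
theorem IsPiSeparable.induction {π : Set ℕ} (hG : IsPiSeparable π G) (N : Subgroup G)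
    [hN : N.Normal] {P : Subgroup G → Prop} (base : P N)
    (step : ∀ K L : Subgroup G, N ≤ K → NormalIn K L → SubnormalIn L ⊤ →
      IsPiNumber π (K.relIndex L) ∨ IsPiNumber πᶜ (K.relIndex L) → P K → P L) : P ⊤ := by
  obtain ⟨n, c, h0, hlast, hc⟩ := hG
  have hn : ∀ i : Fin n, NormalIn (c i.castSucc) (c i.succ) := fun i =>
    normalIn_of_subgroupOf (hc i).1 (hc i).2.1
  have hsub : ∀ i, SubnormalIn (N ⊔ c i) ⊤ := by
    intro i
    induction i using Fin.reverseInduction with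
    | last => rw [hlast, sup_top_eq]; exact .refl _
    | cast i ih => exact .step (hn i).sup_normal ih
  have : ∀ i, P (N ⊔ c i) := by
    intro i
    induction i using Fin.induction with
    | zero => rwa [h0, sup_bot_eq]
    | succ i ih =>
      have hdvd : (N ⊔ c i.castSucc).relIndex (N ⊔ c i.succ) ∣
          (c i.castSucc).relIndex (c i.succ) := by
        have e : N ⊔ c i.succ = c i.succ ⊔ (N ⊔ c i.castSucc) := by
          rw [sup_left_comm, sup_eq_left.2 (hn i).1]
        rw [e, ((hn i).sup_normal (N := N)).relIndex_sup le_sup_right]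
        exact Subgroup.relIndex_dvd_of_le_left _ le_sup_right
      refine step _ _ le_sup_left (hn i).sup_normal (hsub _) ?_ ih
      exact (hc i).2.2.imp (fun h => IsPiNumber.of_dvd h hdvd) fun h => IsPiNumber.of_dvd h hdvd
  have h := this (Fin.last n)
  rwa [hlast, sup_top_eq] at h

end Subnormal

section PermutationDet

theorem det_funCongrLeft_sq {ι : Type} [Fintype ι] {U : Type} [AddCommGroup U] [Module ℂ U]
    [FiniteDimensional ℂ U] (σ : Equiv.Perm ι) :
    LinearMap.det (LinearMap.funLeft ℂ U σ) ^ 2 = 1 := by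
  induction σ using Equiv.Perm.swap_induction_on with
  | one =>
    have : LinearMap.funLeft ℂ U ((1 : Equiv.Perm ι) : ι → ι) = LinearMap.id := by ext; rfl
    rw [this, LinearMap.det_id, one_pow]
  | swap_mul f x y _ ih =>
    have h1 : LinearMap.funLeft ℂ U ((Equiv.swap x y * f : Equiv.Perm ι) : ι → ι)
      = LinearMap.funLeft ℂ U f ∘ₗ LinearMap.funLeft ℂ U (Equiv.swap x y) := by ext; rfl
    have h2 : LinearMap.funLeft ℂ U (Equiv.swap x y) ∘ₗ LinearMap.funLeft ℂ U (Equiv.swap x y) =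
        LinearMap.id := by
      ext v i
      simp [LinearMap.funLeft]
    rw [h1, LinearMap.det_comp, mul_pow, ih, one_mul, sq, ← LinearMap.det_comp, h2,
      LinearMap.det_id]

end PermutationDet

section Induction

variable {G : Type} [Group G] [Finite G] {V : Type} [AddCommGroup V] [Module ℂ V]
  [FiniteDimensional ℂ V] {ρ : Representation ℂ G V} {T L : Subgroup G} {U : Submodule ℂ V}
  {e : V →ₗ[ℂ] V}

omit [Finite G] [FiniteDimensional ℂ V] in
theorem rho_mul_apply (g h : G) (v : V) : ρ (g * h) v = ρ g (ρ h v) := by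
  rw [map_mul, Module.End.mul_apply]

/-- `e` is an idempotent commuting with `T` whose image is a system of imprimitivity
for `G` relative to `T`. -/
structure IsImprimitivityProj (ρ : Representation ℂ G V) (T : Subgroup G) (e : V →ₗ[ℂ] V) :
    Prop where
  idem : ∀ v, e (e v) = e v
  equivariant : EquivariantOn ρ T e
  disjoint : ∀ g ∉ T, ∀ v, e (ρ g (e v)) = 0

omit [Finite G] [FiniteDimensional ℂ V] in
theorem IsImprimitivityProj.apply_of_le_range (he : IsImprimitivityProj ρ T e)
    (hU : U ≤ LinearMap.range e) {u : V} (hu : u ∈ U) : e u = u := by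
  obtain ⟨v, rfl⟩ := hU hu
  exact he.idem v

omit [Finite G] [FiniteDimensional ℂ V] in
theorem IsImprimitivityProj.invOn_range (he : IsImprimitivityProj ρ T e) :
    InvOn ρ T (LinearMap.range e) := by
  rintro g hg _ ⟨v, rfl⟩
  exact ⟨ρ g v, he.equivariant g hg v⟩

omit [Finite G] [FiniteDimensional ℂ V] in
theorem IsImprimitivityProj.apply_rho (he : IsImprimitivityProj ρ T e)
    (hU : U ≤ LinearMap.range e) {u : V} (hu : u ∈ U) (g : G) :
    e (ρ g u) = if g ∈ T then ρ g u else 0 := by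
  split_ifs with hg
  · rw [he.equivariant g hg, he.apply_of_le_range hU hu]
  · rw [← he.apply_of_le_range hU hu, he.disjoint g hg]

omit [Finite G] [FiniteDimensional ℂ V] in
theorem IsImprimitivityProj.apply_translates (he : IsImprimitivityProj ρ T e)
    (hU : U ≤ LinearMap.range e) (hinv : InvOn ρ (T ⊓ L) U) :
    ∀ y ∈ translates ρ L U, e y ∈ U := by
  have : translates ρ L U ≤ U.comap e := by
    refine iSup_le fun g => ?_
    rintro _ ⟨u, hu, rfl⟩
    rw [Submodule.mem_comap, he.apply_rho hU hu]
    split_ifs with hg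
    · exact hinv g ⟨hg, g.2⟩ u hu
    · exact U.zero_mem
  exact this

omit [FiniteDimensional ℂ V] in
theorem IsImprimitivityProj.eq_zero_of_translates (he : IsImprimitivityProj ρ T e)
    (hU : U ≤ LinearMap.range e) {y : V} (hy : y ∈ translates ρ L U)
    (h : ∀ g ∈ L, e (ρ g⁻¹ y) = 0) : y = 0 := by
  have : Fintype L := Fintype.ofFinite L
  let S : V →ₗ[ℂ] V := ∑ g : L, ρ g ∘ₗ e ∘ₗ ρ (g : G)⁻¹
  let c : ℂ := ∑ g : L, if (g : G) ∈ T then 1 else 0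
  have hc : c ≠ 0 := by
    simp only [c, Finset.sum_boole]
    refine Nat.cast_ne_zero.2 (Finset.card_ne_zero.2 ⟨1, ?_⟩)
    simp [T.one_mem]
  have hS : translates ρ L U ≤ LinearMap.ker (S - c • LinearMap.id) := by
    refine iSup_le fun x => ?_
    rintro _ ⟨u, hu, rfl⟩
    rw [LinearMap.mem_ker, LinearMap.sub_apply, sub_eq_zero]
    simp only [S, c, LinearMap.sum_apply, LinearMap.comp_apply, LinearMap.smul_apply,
      LinearMap.id_apply, Finset.sum_smul]
    refine Fintype.sum_equiv ((Equiv.inv L).trans (Equiv.mulRight x)) _ _ fun g => ?_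
    rw [← rho_mul_apply, he.apply_rho hU hu]
    simp only [Equiv.trans_apply, Equiv.inv_apply, Equiv.coe_mulRight, Subgroup.coe_mul,
      InvMemClass.coe_inv]
    split_ifs
    · rw [← Module.End.mul_apply, ← map_mul, mul_inv_cancel_left, one_smul]
    · rw [map_zero, zero_smul]
  have h1 : S y = 0 := by
    simp only [S, LinearMap.sum_apply, LinearMap.comp_apply]
    exact Finset.sum_eq_zero fun g _ => by rw [h g g.2, map_zero]
  have h2 := hS hy
  rw [LinearMap.mem_ker, LinearMap.sub_apply, h1, zero_sub, neg_eq_zero] at h2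
  exact (smul_eq_zero.1 h2).resolve_left hc

omit [FiniteDimensional ℂ V] in
theorem IsImprimitivityProj.irrOn_translates (he : IsImprimitivityProj ρ T e)
    (hL : ∀ U, InvOn ρ L U → ∀ u ∈ U, e u ∈ U)
    (hU : U ≤ LinearMap.range e) (hirr : IrrOn ρ (T ⊓ L) U) : IrrOn ρ L (translates ρ L U) := by
  refine ⟨invOn_translates, fun hbot => hirr.2.1 (eq_bot_iff.2 (hbot ▸ le_translates)),
    fun U' hU' hinv hne => le_antisymm hU' ?_⟩
  obtain ⟨y, hy, hy0⟩ := U'.ne_bot_iff.1 hne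
  obtain ⟨g, hg, hgy⟩ : ∃ g ∈ L, e (ρ g⁻¹ y) ≠ 0 := by
    by_contra! hcon
    exact hy0 (he.eq_zero_of_translates hU (hU' hy) hcon)
  have hgy' := hinv _ (L.inv_mem hg) y hy
  have hmem : e (ρ g⁻¹ y) ∈ U ⊓ U' :=
    ⟨he.apply_translates hU hirr.1 _ (hU' hgy'), hL _ hinv _ hgy'⟩
  have := hirr.2.2 _ inf_le_left (hirr.1.inf (hinv.mono inf_le_right))
    fun hbot => hgy ((Submodule.mem_bot ℂ).1 (hbot ▸ hmem))
  exact translates_le hinv (inf_eq_left.1 this)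

omit [FiniteDimensional ℂ V] in
/-- The span of the translates of `U` as a direct sum over a system of coset representatives. -/
theorem IsImprimitivityProj.exists_equiv (he : IsImprimitivityProj ρ T e)
    (hU : U ≤ LinearMap.range e) (hinv : InvOn ρ (T ⊓ L) U)
    (r : L ⧸ T.subgroupOf L → L) (hr : ∀ q, (r q : L ⧸ T.subgroupOf L) = q) :
    ∃ Φ : (L ⧸ T.subgroupOf L → U) ≃ₗ[ℂ] translates ρ L U,
      ∀ f, (Φ f : V) = ∑ᶠ q, ρ (r q) (f q) := by
  have : Fintype (L ⧸ T.subgroupOf L) := Fintype.ofFinite _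
  have hT : ∀ q q', ((r q : G)⁻¹ * r q' ∈ T ↔ q = q') := by
    intro q q'
    conv_rhs => rw [← hr q, ← hr q', QuotientGroup.eq]
    rfl
  let F : (L ⧸ T.subgroupOf L → U) →ₗ[ℂ] V :=
    ∑ q, ρ (r q) ∘ₗ U.subtype ∘ₗ LinearMap.proj q
  have hF : ∀ f, F f = ∑ q, ρ (r q) (f q) := fun f => by simp [F]
  have hcoord : ∀ f q, e (ρ (r q : G)⁻¹ (F f)) = f q := by
    intro f q
    rw [hF, map_sum, map_sum, Finset.sum_eq_single q]
    · rw [rho_inv_apply_apply, he.apply_of_le_range hU (f q).2]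
    · intro q' _ hq'
      rw [← rho_mul_apply, he.apply_rho hU (f q').2,
        if_neg fun h => hq' ((hT _ _).1 h).symm]
    · simp
  have hinj : Function.Injective F := fun f f' hff => by
    funext q
    apply Subtype.ext
    rw [← hcoord f, hff, hcoord]
  have hrange : LinearMap.range F = translates ρ L U := by
    apply le_antisymm
    · rintro _ ⟨f, rfl⟩
      rw [hF]
      exact Submodule.sum_mem _ fun q _ => invOn_translates _ (r q).2 _ (le_translates (f q).2)
    · refine iSup_le fun g => ?_
      rintro _ ⟨u, hu, rfl⟩
      have hg : (r (g : L ⧸ T.subgroupOf L))⁻¹ * g ∈ T.subgroupOf L := by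
        rw [← QuotientGroup.eq, hr]
      refine ⟨Pi.single (g : L ⧸ T.subgroupOf L)
        ⟨ρ ((r (g : L ⧸ T.subgroupOf L))⁻¹ * g : L) u,
          hinv _ ⟨hg, ((r (g : L ⧸ T.subgroupOf L))⁻¹ * g).2⟩ u hu⟩, ?_⟩
      rw [hF, Finset.sum_eq_single (g : L ⧸ T.subgroupOf L)]
      · rw [Pi.single_eq_same, ← Module.End.mul_apply, ← map_mul]
        simp
      · intro q _ hq
        rw [Pi.single_eq_of_ne hq]
        simp
      · simp
  refine ⟨(LinearEquiv.ofInjective F hinj).trans (LinearEquiv.ofEq _ _ hrange), fun f => ?_⟩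
  rw [finsum_eq_sum_of_fintype, ← hF]
  rfl

theorem IsImprimitivityProj.finrank_translates (he : IsImprimitivityProj ρ T e)
    (hU : U ≤ LinearMap.range e) (hinv : InvOn ρ (T ⊓ L) U) :
    Module.finrank ℂ (translates ρ L U) = T.relIndex L * Module.finrank ℂ U := by
  have : Fintype (L ⧸ T.subgroupOf L) := Fintype.ofFinite _
  obtain ⟨Φ, -⟩ := he.exists_equiv hU hinv Quotient.out fun q => Quotient.out_eq q
  rw [← Φ.finrank_eq, Module.finrank_pi_fintype, Finset.sum_const, Finset.card_univ,
    Subgroup.relIndex, Subgroup.index, Nat.card_eq_fintype_card, smul_eq_mul]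

theorem IsImprimitivityProj.detOn_translates (he : IsImprimitivityProj ρ T e)
    (hU : U ≤ LinearMap.range e) (hinv : InvOn ρ (T ⊓ L) U)
    (r : L ⧸ T.subgroupOf L → L) (hr : ∀ q, (r q : L ⧸ T.subgroupOf L) = q) (h : L) :
    ∃ δ : ℂ, δ ^ 2 = 1 ∧ detOn (ρ h) (translates ρ L U) =
      δ * ∏ᶠ q, detOn (ρ ((r (h • q) : G)⁻¹ * h * r q)) U := by
  have : Fintype (L ⧸ T.subgroupOf L) := Fintype.ofFinite _
  obtain ⟨Φ, hΦ⟩ := he.exists_equiv hU hinv r hr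
  simp only [finsum_eq_sum_of_fintype] at hΦ
  have hmem : ∀ q, (r (h • q) : G)⁻¹ * h * r q ∈ T ⊓ L := by
    intro q
    refine ⟨?_, SetLike.coe_mem ((r (h • q))⁻¹ * h * r q)⟩
    have : (r (h • q))⁻¹ * (h * r q) ∈ T.subgroupOf L := by
      rw [← QuotientGroup.eq, hr]
      conv_lhs => rw [← hr q]
      rfl
    rw [mul_assoc]
    exact this
  let t : L ⧸ T.subgroupOf L → U →ₗ[ℂ] U := fun q =>
    (ρ ((r (h • q) : G)⁻¹ * h * r q)).restrict (hinv _ (hmem q))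
  let D : (L ⧸ T.subgroupOf L → U) →ₗ[ℂ] (L ⧸ T.subgroupOf L → U) :=
    LinearMap.pi fun q => (t q).comp (LinearMap.proj q)
  let P := LinearMap.funLeft ℂ U ((MulAction.toPerm h⁻¹ : Equiv.Perm (L ⧸ T.subgroupOf L)))
  refine ⟨LinearMap.det P, det_funCongrLeft_sq _, ?_⟩
  rw [finprod_eq_prod_of_fintype, detOn_eq (invOn_translates (ρ := ρ) (M := L) h h.2)]
  have h1 : ∀ q, detOn (ρ ((r (h • q) : G)⁻¹ * h * r q)) U = LinearMap.det (t q) := fun q =>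
    detOn_eq _
  rw [Finset.prod_congr rfl fun q _ => h1 q, ← LinearMap.det_pi, ← LinearMap.det_comp]
  symm
  refine det_eq_of_equiv Φ fun f => Subtype.ext ?_
  rw [hΦ, LinearMap.coe_restrict_apply, hΦ, map_sum]
  symm
  refine Fintype.sum_equiv (MulAction.toPerm h) _ _ fun q => ?_
  simp only [P, t, LinearMap.comp_apply, LinearMap.funLeft_apply, MulAction.toPerm_apply,
    LinearMap.pi_apply, LinearMap.proj_apply, inv_smul_smul, LinearMap.coe_restrict_apply]
  rw [← Module.End.mul_apply, ← Module.End.mul_apply, ← map_mul, ← map_mul]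
  congr 2
  group

end Induction

section MatrixAction

open Matrix

variable {k : ℕ}

theorem Matrix.algEquiv_exists_conj [NeZero k]
    (f : Matrix (Fin k) (Fin k) ℂ ≃ₐ[ℂ] Matrix (Fin k) (Fin k) ℂ) :
    ∃ R : Matrix (Fin k) (Fin k) ℂ, R.det = 1 ∧ ∀ b, f b = R * b * R⁻¹ := by
  let τ : Matrix (Fin k) (Fin k) ℂ ≃ₐ[ℂ] Module.End ℂ (Fin k → ℂ) := Matrix.toLinAlgEquiv'
  obtain ⟨E, hE⟩ := ((τ.symm.trans f).trans τ).eq_linearEquivConjAlgEquiv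
  have h1 : ∀ b, τ (f b) * E.toLinearMap = E.toLinearMap * τ b := by
    intro b
    have := AlgEquiv.congr_fun hE (τ b)
    simp only [AlgEquiv.trans_apply, AlgEquiv.symm_apply_apply,
      LinearEquiv.conjAlgEquiv_apply] at this
    rw [this]
    ext v
    simp
  let R₀ := τ.symm E.toLinearMap
  have h2 : ∀ b, f b * R₀ = R₀ * b := fun b => by
    apply τ.injective
    simp [R₀, h1]
  have hd : R₀.det ≠ 0 := by
    have : R₀ * τ.symm E.symm.toLinearMap = 1 := by
      rw [← map_mul]
      have : E.toLinearMap * E.symm.toLinearMap = 1 := by ext; simp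
      rw [this, map_one]
    intro h0
    have := congrArg Matrix.det this
    rw [Matrix.det_mul, h0, zero_mul, Matrix.det_one] at this
    exact zero_ne_one this
  obtain ⟨c, hc⟩ := IsAlgClosed.exists_pow_nat_eq R₀.det⁻¹ (NeZero.pos k)
  have hdet : (c • R₀).det = 1 := by
    rw [Matrix.det_smul, Fintype.card_fin, hc, inv_mul_cancel₀ hd]
  refine ⟨c • R₀, hdet, fun b => ?_⟩
  have hu : IsUnit (c • R₀).det := by rw [hdet]; exact isUnit_one
  have h3 : f b * (c • R₀) = c • R₀ * b := by rw [Matrix.mul_smul, h2, Matrix.smul_mul]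
  rw [← h3, Matrix.mul_nonsing_inv_cancel_right _ _ hu]

theorem Matrix.exists_scalar_of_commute {b : Matrix (Fin k) (Fin k) ℂ}
    (h : ∀ a, a * b = b * a) : ∃ c : ℂ, b = c • 1 := by
  obtain ⟨c, hc⟩ := Matrix.mem_range_scalar_iff_commute_single'.2 fun i j => h (single i j 1)
  exact ⟨c, by rw [← hc]; ext; simp [Matrix.scalar_apply, Matrix.diagonal_apply, Matrix.one_apply]⟩

theorem exists_natCast_eq_of_isIntegral_sq {m n : ℕ} (hn : n ≠ 0)
    (h : IsIntegral ℤ (((m : ℂ) / n) ^ 2)) : n ∣ m := by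
  have h1 : IsIntegral ℤ ((m : ℂ) / n) := h.of_pow two_pos
  have h2 : IsIntegral ℤ ((m : ℚ) / n) := by
    have e : ((m : ℂ) / n) = algebraMap ℚ ℂ ((m : ℚ) / n) := by simp
    rw [e, isIntegral_algebraMap_iff (algebraMap ℚ ℂ).injective] at h1
    exact h1
  obtain ⟨z, hz⟩ := IsIntegrallyClosed.isIntegral_iff.1 h2
  have hn' : (n : ℚ) ≠ 0 := Nat.cast_ne_zero.2 hn
  rw [eq_div_iff hn'] at hz
  have hz' : z * (n : ℤ) = m := by
    simp only [algebraMap_int_eq, eq_intCast] at hz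
    exact_mod_cast hz
  exact Int.natCast_dvd_natCast.1 ⟨z, by rw [← hz', mul_comm]⟩

/-- If a finite group acts on a matrix algebra with only scalar fixed points, then the size of
the matrices divides the order of the group. -/
theorem Matrix.dvd_card_of_fixedPoints_scalar {Q : Type} [Group Q] [Fintype Q] [NeZero k]
    (φ : Q → (Matrix (Fin k) (Fin k) ℂ ≃ₐ[ℂ] Matrix (Fin k) (Fin k) ℂ))
    (hmul : ∀ g h b, φ (g * h) b = φ g (φ h b))
    (hfix : ∀ b, (∀ q, φ q b = b) → ∃ c : ℂ, b = c • 1) : k ∣ Fintype.card Q := by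
  choose R hdet hR using fun q => Matrix.algEquiv_exists_conj (φ q)
  have hu : ∀ q, IsUnit (R q).det := fun q => by rw [hdet]; exact isUnit_one
  have hk : (k : ℂ) ≠ 0 := Nat.cast_ne_zero.2 (NeZero.ne k)
  -- averaging
  have havg : ∀ b, ∑ q, R q * b * (R q)⁻¹ = ((Fintype.card Q : ℂ) / k * b.trace) • 1 := by
    intro b
    obtain ⟨c, hc⟩ := hfix (∑ q, φ q b) fun g => by
      rw [map_sum]
      exact Fintype.sum_equiv (Equiv.mulLeft g) _ _ fun h => (hmul g h b).symm
    have htr : (∑ q, φ q b).trace = Fintype.card Q * b.trace := by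
      rw [Matrix.trace_sum, Finset.sum_congr rfl fun q _ => ?_, Finset.sum_const, Finset.card_univ,
        nsmul_eq_mul]
      rw [hR, Matrix.trace_mul_cycle, Matrix.nonsing_inv_mul _ (hu q), one_mul]
    rw [hc, Matrix.trace_smul, Matrix.trace_one, Fintype.card_fin, smul_eq_mul] at htr
    rw [← Finset.sum_congr rfl fun q _ => hR q b, hc]
    congr 1
    field_simp
    exact htr
  -- projective multiplicativity
  have hproj : ∀ g h, ∃ ζ : ℂ, ζ ^ k = 1 ∧ R g * R h = ζ • R (g * h) := by
    intro g h
    have hcomm : ∀ b, (R g * R h) * b = R (g * h) * b * (R (g * h))⁻¹ * (R g * R h) := by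
      intro b
      rw [← hR, hmul, hR g, hR h]
      simp only [← mul_assoc]
      rw [Matrix.nonsing_inv_mul_cancel_right _ _ (hu g),
        Matrix.nonsing_inv_mul_cancel_right _ _ (hu h)]
    obtain ⟨ζ, hζ⟩ := Matrix.exists_scalar_of_commute (b := (R (g * h))⁻¹ * (R g * R h)) fun b => by
      rw [mul_assoc ((R (g * h))⁻¹), hcomm]
      simp only [← mul_assoc]
      rw [Matrix.nonsing_inv_mul _ (hu _), one_mul]
    have hζ' : R g * R h = ζ • R (g * h) := by
      have := congrArg (R (g * h) * ·) hζ
      simpa [Matrix.mul_nonsing_inv_cancel_left _ _ (hu (g * h))] using this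
    refine ⟨ζ, ?_, hζ'⟩
    have := congrArg Matrix.det hζ'
    simpa [Matrix.det_smul, hdet] using this.symm
  let μ : Set ℂ := {ζ | ζ ^ k = 1}
  have hμ : μ.Finite := by
    have := (Polynomial.nthRoots k (1 : ℂ)).toFinset.finite_toSet
    refine this.subset fun ζ hζ => ?_
    simpa [Polynomial.mem_nthRoots (NeZero.pos k)] using show ζ ^ k = 1 from hζ
  let Γ : Set (Matrix (Fin k) (Fin k) ℂ) := (fun x : ℂ × Q => x.1 • R x.2) '' (μ ×ˢ Set.univ)
  have hΓ : Γ.Finite := (hμ.prod Set.finite_univ).image _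
  let N : Submodule ℤ (Matrix (Fin k) (Fin k) ℂ) := Submodule.span ℤ Γ
  have hleft : ∀ a, (∀ γ ∈ Γ, a * γ ∈ Γ) → ∀ n ∈ N, a * n ∈ N := by
    intro a ha n hn
    induction hn using Submodule.span_induction with
    | mem x hx => exact Submodule.subset_span (ha x hx)
    | zero => rw [mul_zero]; exact N.zero_mem
    | add x y _ _ hx hy => rw [mul_add]; exact N.add_mem hx hy
    | smul z x _ hx => rw [mul_smul_comm]; exact N.smul_mem z hx
  have hl1 : ∀ g, ∀ γ ∈ Γ, R g * γ ∈ Γ := by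
    rintro g _ ⟨⟨ζ, x⟩, ⟨hζ, -⟩, rfl⟩
    obtain ⟨ξ, hξ, h⟩ := hproj g x
    refine ⟨⟨ζ * ξ, g * x⟩, ⟨?_, Set.mem_univ _⟩, ?_⟩
    · change (ζ * ξ) ^ k = 1
      rw [mul_pow, hξ, mul_one]
      exact hζ
    · simp only [Matrix.mul_smul, h, smul_smul]
  have hl2 : ∀ g, ∀ γ ∈ Γ, (R g)⁻¹ * γ ∈ Γ := by
    rintro g _ ⟨⟨ζ, x⟩, ⟨hζ, -⟩, rfl⟩
    obtain ⟨ξ, hξ, h⟩ := hproj g (g⁻¹ * x)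
    have hξ0 : ξ ≠ 0 := by
      rintro rfl
      rw [zero_pow (NeZero.ne k)] at hξ
      exact zero_ne_one hξ
    refine ⟨⟨ζ * ξ⁻¹, g⁻¹ * x⟩, ⟨?_, Set.mem_univ _⟩, ?_⟩
    · change (ζ * ξ⁻¹) ^ k = 1
      rw [mul_pow, inv_pow, hξ, inv_one, mul_one]
      exact hζ
    · rw [mul_inv_cancel_left] at h
      have h' : R x = ξ⁻¹ • (R g * R (g⁻¹ * x)) := by
        rw [h, smul_smul, inv_mul_cancel₀ hξ0, one_smul]
      simp only [h', Matrix.mul_smul, Matrix.nonsing_inv_mul_cancel_left _ _ (hu g), smul_smul]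
  have hZ : ∑ g, ∑ h, R h * R g * (R h)⁻¹ * (R g)⁻¹ =
      (((Fintype.card Q : ℂ) / k) ^ 2) • (1 : Matrix (Fin k) (Fin k) ℂ) := by
    have h1 : ∀ g, ∑ h, R h * R g * (R h)⁻¹ * (R g)⁻¹ =
        ((Fintype.card Q : ℂ) / k * (R g).trace) • (R g)⁻¹ := fun g => by
      rw [← Finset.sum_mul, havg, Matrix.smul_mul, one_mul]
    rw [Finset.sum_congr rfl fun g _ => h1 g]
    ext a b
    have h2 : ∀ i, ∑ g, R g i i * (R g)⁻¹ a b =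
        (Fintype.card Q : ℂ) / k * (if i = a then 1 else 0) * (if i = b then 1 else 0) := by
      intro i
      have := congrFun (congrFun (havg (single i a 1)) i) b
      rw [Matrix.sum_apply] at this
      simp only [Matrix.mul_apply, Matrix.single_apply, Matrix.smul_apply, Matrix.one_apply,
        smul_eq_mul] at this
      have htr : (single i a (1 : ℂ)).trace = if i = a then 1 else 0 := by
        rcases eq_or_ne i a with rfl | hia
        · simp
        · rw [Matrix.trace_single_eq_of_ne _ _ _ hia, if_neg hia]
      rw [htr] at this
      rw [← this]
      refine Finset.sum_congr rfl fun g _ => ?_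
      simp [ite_and, Finset.sum_ite_eq]
    simp only [Matrix.sum_apply, Matrix.smul_apply, smul_eq_mul, Matrix.trace, Matrix.diag_apply,
      Matrix.one_apply]
    simp only [mul_assoc, ← Finset.mul_sum, Finset.sum_mul]
    rw [Finset.sum_comm, Finset.sum_congr rfl fun i _ => h2 i]
    rcases eq_or_ne a b with rfl | hab
    · simp [sq]
    · have : ∀ i, (Fintype.card Q : ℂ) / k * (if i = a then 1 else 0) *
        (if i = b then 1 else 0) = 0 := by
        intro i
        split_ifs with h3 h4
        · exact absurd (h3.symm.trans h4) hab
        all_goals simp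
      rw [Finset.sum_eq_zero fun i _ => this i, if_neg hab, mul_zero, mul_zero]
  refine exists_natCast_eq_of_isIntegral_sq (NeZero.ne k) ?_
  refine isIntegral_of_smul_mem_submodule N ?_ ⟨hΓ.toFinset, by simp [N]⟩ _ fun n hn => ?_
  · refine N.ne_bot_iff.2 ⟨R 1, Submodule.subset_span ⟨⟨1, 1⟩, ⟨one_pow k, Set.mem_univ _⟩, by simp⟩,
      fun h0 => ?_⟩
    have h1 := hdet 1
    have : Nonempty (Fin k) := ⟨0⟩
    rw [h0, Matrix.det_zero] at h1
    exact zero_ne_one h1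
  · have : (((Fintype.card Q : ℂ) / k) ^ 2) • n =
        ((((Fintype.card Q : ℂ) / k) ^ 2) • (1 : Matrix (Fin k) (Fin k) ℂ)) * n := by
      rw [Matrix.smul_mul, one_mul]
    rw [this, ← hZ, Finset.sum_mul]
    refine N.sum_mem fun g _ => ?_
    rw [Finset.sum_mul]
    refine N.sum_mem fun h _ => ?_
    simp only [mul_assoc]
    exact hleft _ (hl1 h) _ (hleft _ (hl1 g) _ (hleft _ (hl2 h) _ (hleft _ (hl2 g) n hn)))

end MatrixAction

section Schur

variable {G : Type} [Group G] {V : Type} [AddCommGroup V] [Module ℂ V] [FiniteDimensional ℂ V]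
  {ρ : Representation ℂ G V} {M : Subgroup G} {U : Submodule ℂ V} {p : V →ₗ[ℂ] V}

theorem IrrOn.exists_scalar (h : IrrOn ρ M U) (hp : EquivariantOn ρ M p) (hU : ∀ u ∈ U, p u ∈ U) :
    ∃ c : ℂ, ∀ u ∈ U, p u = c • u := by
  have : Nontrivial U := Submodule.nontrivial_iff_ne_bot.2 h.2.1
  obtain ⟨c, hc⟩ := Module.End.exists_eigenvalue (p.restrict hU)
  obtain ⟨u, hu⟩ := hc.exists_hasEigenvector
  refine ⟨c, fun v hv => ?_⟩
  have hq : EquivariantOn ρ M (p - c • LinearMap.id) := fun g hg v => by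
    simp [hp g hg]
  have hu0 : (u : V) ≠ 0 := fun h0 => hu.2 (Subtype.ext h0)
  have hpu : p u = c • (u : V) := congrArg Subtype.val hu.apply_eq_smul
  have hmem : (u : V) ∈ U ⊓ LinearMap.ker (p - c • LinearMap.id) :=
    ⟨u.2, by rw [SetLike.mem_coe, LinearMap.mem_ker]; simp [hpu]⟩
  have := h.2.2 _ inf_le_left (h.1.inf hq.invOn_ker)
    fun hbot => hu0 ((Submodule.mem_bot ℂ).1 (hbot ▸ hmem))
  have hv' := (inf_eq_left.1 this) hv
  rw [LinearMap.mem_ker] at hv'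
  simpa [sub_eq_zero] using hv'

/-- The representation of `M` on an invariant subspace. -/
def subRep (ρ : Representation ℂ G V) (M : Subgroup G) (U : Submodule ℂ V) (h : InvOn ρ M U) :
    Representation ℂ M U where
  toFun m := (ρ m).restrict (h m m.2)
  map_one' := by ext; simp
  map_mul' a b := by ext; simp

omit [FiniteDimensional ℂ V] in
theorem subRep_apply (h : InvOn ρ M U) (m : M) (u : U) :
    (subRep ρ M U h m u : V) = ρ m u := rfl

omit [FiniteDimensional ℂ V] in
theorem subRep_map_subtype_invOn (h : InvOn ρ M U) {X : Subgroup M} {U' : Submodule ℂ U} :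
    InvOn (subRep ρ M U h) X U' ↔ InvOn ρ (X.map M.subtype) (U'.map U.subtype) := by
  constructor
  · rintro hinv _ ⟨x, hx, rfl⟩ _ ⟨u, hu, rfl⟩
    exact ⟨_, hinv x hx u hu, rfl⟩
  · intro hinv x hx u hu
    obtain ⟨u', hu', h'⟩ := hinv x ⟨x, hx, rfl⟩ u ⟨u, hu, rfl⟩
    rwa [Subtype.ext (a1 := subRep ρ M U h x u) (a2 := u') h'.symm]

omit [FiniteDimensional ℂ V] in
theorem subRep_irrOn_iff (h : InvOn ρ M U) {X : Subgroup M} {U' : Submodule ℂ U} :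
    IrrOn (subRep ρ M U h) X U' ↔ IrrOn ρ (X.map M.subtype) (U'.map U.subtype) := by
  have hinj : Function.Injective (Submodule.map U.subtype) :=
    Submodule.map_injective_of_injective U.subtype_injective
  have hbot : ∀ A : Submodule ℂ U, A = ⊥ ↔ A.map U.subtype = ⊥ := fun A => by
    rw [← hinj.eq_iff, Submodule.map_bot]
  rw [IrrOn, IrrOn, subRep_map_subtype_invOn, Ne, hbot]
  refine and_congr_right fun _ => and_congr_right fun _ => ⟨fun hmin A hA hinv hne => ?_,
    fun hmin A hA hinv hne => ?_⟩
  · have hAU : A ≤ U := hA.trans (Submodule.map_subtype_le U U')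
    have hA' : (A.comap U.subtype).map U.subtype = A := by
      rw [Submodule.map_comap_subtype, inf_eq_right.2 hAU]
    rw [← hA'] at hinv hne hA ⊢
    congr 1
    refine hmin _ ?_ (subRep_map_subtype_invOn h |>.2 hinv) fun hb => hne ((hbot _).1 hb)
    intro u hu
    obtain ⟨u', hu', h'⟩ := hA ⟨u, hu, rfl⟩
    rwa [← U.subtype_injective h']
  · exact hinj (hmin _ (Submodule.map_mono hA) (subRep_map_subtype_invOn h |>.1 hinv)
      fun hb => hne ((hbot _).2 hb))

omit [FiniteDimensional ℂ V] in
theorem subRep_irrOn_top (h : InvOn ρ M U) : IrrOn (subRep ρ M U h) ⊤ ⊤ ↔ IrrOn ρ M U := by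
  rw [subRep_irrOn_iff, ← MonoidHom.range_eq_map, Subgroup.range_subtype, Submodule.map_subtype_top]

end Schur

section Characters

open Representation

variable {H : Type} [Group H] {A B : Type} [AddCommGroup A] [Module ℂ A] [FiniteDimensional ℂ A]
  [AddCommGroup B] [Module ℂ B] [FiniteDimensional ℂ B]
  {σ : Representation ℂ H A} {τ : Representation ℂ H B}

omit [FiniteDimensional ℂ A] [FiniteDimensional ℂ B] in
theorem intertwining_apply (f : IntertwiningMap σ τ) (g : H) (a : A) :
    f.toLinearMap (σ g a) = τ g (f.toLinearMap a) :=
  IntertwiningMap.isIntertwining σ τ f g a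

omit [FiniteDimensional ℂ A] [FiniteDimensional ℂ B] in
theorem IrrOn.intertwining_injective (hσ : IrrOn σ ⊤ ⊤) (f : IntertwiningMap σ τ) (hf : f ≠ 0) :
    Function.Injective f.toLinearMap := by
  rw [← LinearMap.ker_eq_bot]
  by_contra hne
  refine hf (IntertwiningMap.ext ?_)
  have := hσ.2.2 (LinearMap.ker f.toLinearMap) le_top (fun g _ u hu => ?_) hne
  · exact LinearMap.ker_eq_top.1 this
  · rw [LinearMap.mem_ker] at hu ⊢
    rw [intertwining_apply, hu, map_zero]

omit [FiniteDimensional ℂ A] [FiniteDimensional ℂ B] in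
theorem IrrOn.intertwining_surjective (hτ : IrrOn τ ⊤ ⊤) (f : IntertwiningMap σ τ) (hf : f ≠ 0) :
    Function.Surjective f.toLinearMap := by
  rw [← LinearMap.range_eq_top]
  refine hτ.2.2 (LinearMap.range f.toLinearMap) le_top ?_ fun hbot => ?_
  · rintro g _ _ ⟨u, rfl⟩
    exact ⟨σ g u, intertwining_apply f g u⟩
  · exact hf (IntertwiningMap.ext (LinearMap.range_eq_bot.1 hbot))

theorem IrrOn.finrank_intertwining_self (hσ : IrrOn σ ⊤ ⊤) :
    Module.finrank ℂ (IntertwiningMap σ σ) = 1 := by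
  have : Nontrivial A := by
    by_contra hA
    rw [not_nontrivial_iff_subsingleton] at hA
    exact hσ.2.1 (Subsingleton.elim _ _)
  have hid : IntertwiningMap.id σ ≠ 0 := fun h0 => by
    obtain ⟨a, ha⟩ := exists_ne (0 : A)
    exact ha (congrArg (fun f : IntertwiningMap σ σ => f a) h0)
  refine finrank_eq_one _ hid fun f => ?_
  obtain ⟨c, hc⟩ := hσ.exists_scalar (p := f.toLinearMap) (fun g _ v => intertwining_apply f g v)
    fun _ _ => Submodule.mem_top
  refine ⟨c, IntertwiningMap.ext ?_⟩
  ext v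
  exact (hc v Submodule.mem_top).symm

omit [FiniteDimensional ℂ A] [FiniteDimensional ℂ B] in
theorem character_eq_of_bijective (f : IntertwiningMap σ τ)
    (hf : Function.Bijective f.toLinearMap) : σ.character = τ.character := by
  ext g
  let e := LinearEquiv.ofBijective f.toLinearMap hf
  rw [character, character, ← LinearMap.trace_conj' (σ g) e]
  congr 1
  ext v
  obtain ⟨u, rfl⟩ := e.surjective v
  simp only [LinearEquiv.conj_apply, LinearMap.comp_apply, LinearEquiv.coe_coe,
    LinearEquiv.symm_apply_apply]
  exact intertwining_apply f g u

variable [Fintype H]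

theorem sum_character_mul :
    ∑ g : H, τ.character g * σ.character g⁻¹ =
      Nat.card H * Module.finrank ℂ (IntertwiningMap σ τ) := by
  have hc : (Nat.card H : ℂ) ≠ 0 := Nat.cast_ne_zero.2 Nat.card_pos.ne'
  have := invertibleOfNonzero hc
  rw [← card_inv_mul_sum_char_mul_char_eq_finrank, mul_inv_cancel_left₀ hc]

theorem exists_intertwining_ne_zero (h : ∑ g : H, τ.character g * σ.character g⁻¹ ≠ 0) :
    ∃ f : IntertwiningMap σ τ, f ≠ 0 := by
  by_contra! hcon
  have : Subsingleton (IntertwiningMap σ τ) := ⟨fun f g => by rw [hcon f, hcon g]⟩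
  apply h
  rw [sum_character_mul, Module.finrank_zero_of_subsingleton]
  simp

theorem IrrOn.sum_character_mul (hσ : IrrOn σ ⊤ ⊤) (hτ : IrrOn τ ⊤ ⊤) :
    ∑ g : H, τ.character g * σ.character g⁻¹ =
      if σ.character = τ.character then (Nat.card H : ℂ) else 0 := by
  split_ifs with h
  · rw [← h, _root_.sum_character_mul, hσ.finrank_intertwining_self, Nat.cast_one, mul_one]
  · by_contra hne
    obtain ⟨f, hf⟩ := exists_intertwining_ne_zero hne
    exact h (character_eq_of_bijective f
      ⟨hσ.intertwining_injective f hf, hτ.intertwining_surjective f hf⟩)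

end Characters

section IsotypicProjection

open Representation

variable {G : Type} [Group G] [Finite G] {V : Type} [AddCommGroup V] [Module ℂ V]
  [FiniteDimensional ℂ V] {ρ : Representation ℂ G V} {N T : Subgroup G} {U A A' : Submodule ℂ V}
  {B : Type} [AddCommGroup B] [Module ℂ B] [FiniteDimensional ℂ B] {σ : Representation ℂ N B}

omit [Finite G] in
theorem IrrOn.finrank_ne_zero (hA : IrrOn ρ N A) : (Module.finrank ℂ A : ℂ) ≠ 0 := by
  rw [Nat.cast_ne_zero, Ne, Submodule.finrank_eq_zero]
  exact hA.2.1

/-- The projection onto the isotypic component belonging to the character `θ` of `N`. -/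
def isoProj (ρ : Representation ℂ G V) (N : Subgroup G) (θ : N → ℂ) : V →ₗ[ℂ] V :=
  (θ 1 / Nat.card N) • ∑ᶠ n : N, θ n⁻¹ • ρ n

omit [Finite G] [FiniteDimensional ℂ V] in
theorem isoProj_apply [Fintype N] (θ : N → ℂ) (v : V) :
    isoProj ρ N θ v = (θ 1 / Nat.card N) • ∑ n : N, θ n⁻¹ • ρ n v := by
  rw [isoProj, finsum_eq_sum_of_fintype]
  simp

omit [FiniteDimensional ℂ V] in
theorem isoProj_mem (hU : InvOn ρ N U) (θ : N → ℂ) : ∀ u ∈ U, isoProj ρ N θ u ∈ U := by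
  intro u hu
  have : Fintype N := Fintype.ofFinite N
  rw [isoProj_apply]
  exact U.smul_mem _ (U.sum_mem fun n _ => U.smul_mem _ (hU n n.2 u hu))

omit [FiniteDimensional ℂ V] in
theorem isoProj_rho (hN : N.Normal) {θ : N → ℂ} {g : G}
    (hg : ∀ x : N, θ ⟨g * x * g⁻¹, hN.conj_mem x x.2 g⟩ = θ x) (v : V) :
    isoProj ρ N θ (ρ g v) = ρ g (isoProj ρ N θ v) := by
  have : Fintype N := Fintype.ofFinite N
  simp only [isoProj_apply, map_smul, map_sum]
  congr 1
  let c : N ≃ N := (MulAut.conjNormal (H := N) g).toEquiv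
  rw [← c.sum_comp]
  refine Finset.sum_congr rfl fun x _ => ?_
  have hc : ∀ y : N, (c y : G) = g * y * g⁻¹ := fun y => MulAut.conjNormal_apply g y
  have hinv : (c x)⁻¹ = c x⁻¹ := (map_inv (MulAut.conjNormal (H := N) g) x).symm
  have hθ : θ (c x⁻¹) = θ x⁻¹ := by
    rw [← hg x⁻¹]
    exact congrArg θ (Subtype.ext (hc _))
  rw [hinv, hθ, ← rho_mul_apply, hc, ← rho_mul_apply]
  simp

theorem IrrOn.isoProj_apply (hA : IrrOn ρ N A) (hσ : IrrOn σ ⊤ ⊤) :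
    ∀ a ∈ A, isoProj ρ N σ.character a =
      if (subRep ρ N A hA.1).character = σ.character then a else 0 := by
  have : Fintype N := Fintype.ofFinite N
  have hconj : EquivariantOn ρ N (isoProj ρ N σ.character) := by
    intro g hg v
    simp only [_root_.isoProj_apply, map_smul, map_sum]
    congr 1
    let c : N ≃ N := (MulAut.conj (⟨g, hg⟩ : N)).toEquiv
    rw [← c.sum_comp]
    refine Finset.sum_congr rfl fun x _ => ?_
    have hinv : (c x)⁻¹ = c x⁻¹ := (map_inv (MulAut.conj (⟨g, hg⟩ : N)) x).symm
    have hc : ∀ y : N, c y = ⟨g, hg⟩ * y * ⟨g, hg⟩⁻¹ := fun y => rfl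
    rw [hinv, hc x⁻¹, char_conj, ← rho_mul_apply, hc, ← rho_mul_apply]
    simp
  obtain ⟨c, hc⟩ := hA.exists_scalar hconj (isoProj_mem hA.1 _)
  have htr : c * Module.finrank ℂ A = (σ.character 1 / Nat.card N) *
      if (subRep ρ N A hA.1).character = σ.character then (Nat.card N : ℂ) else 0 := by
    have h1 : (isoProj ρ N σ.character).restrict (isoProj_mem hA.1 _) = c • LinearMap.id := by
      ext a
      exact hc a a.2
    have h2 : (isoProj ρ N σ.character).restrict (isoProj_mem hA.1 _) =
        (σ.character 1 / Nat.card N) •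
          ∑ n : N, σ.character n⁻¹ • subRep ρ N A hA.1 n := by
      ext a
      simp [_root_.isoProj_apply, subRep_apply]
    have h3 := congrArg (LinearMap.trace ℂ A) (h1.symm.trans h2)
    simp only [map_smul, map_sum, LinearMap.trace_id, smul_eq_mul] at h3
    rw [h3]
    congr 1
    exact (Finset.sum_congr rfl fun n _ => mul_comm _ _).trans
      ((hσ.sum_character_mul ((subRep_irrOn_top hA.1).2 hA)).trans (if_congr eq_comm rfl rfl))
  intro a ha
  rw [hc a ha]
  split_ifs with h
  · rw [if_pos h, div_mul_cancel₀ _ (Nat.cast_ne_zero.2 Nat.card_pos.ne'), ← h,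
      Representation.char_one] at htr
    rw [mul_right_cancel₀ hA.finrank_ne_zero (htr.trans (one_mul _).symm), one_smul]
  · rw [if_neg h, mul_zero] at htr
    rw [(mul_eq_zero.1 htr).resolve_right hA.finrank_ne_zero, zero_smul]

omit [Finite G] [FiniteDimensional ℂ V] in
theorem character_translate (hN : N.Normal) (hA : InvOn ρ N A) (g : G)
    (hgA : InvOn ρ N (A.map (ρ g))) (x : N) :
    (subRep ρ N _ hgA).character ⟨g * x * g⁻¹, hN.conj_mem x x.2 g⟩ =
      (subRep ρ N A hA).character x := by
  let e : A ≃ₗ[ℂ] A.map (ρ g) := A.equivMapOfInjective (ρ g) fun v w h => by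
    rw [← rho_inv_apply_apply (ρ := ρ) g v, h, rho_inv_apply_apply]
  rw [Representation.character, Representation.character, ← LinearMap.trace_conj' _ e]
  congr 1
  ext v
  obtain ⟨u, rfl⟩ := e.surjective v
  simp only [LinearEquiv.conj_apply, LinearMap.comp_apply, LinearEquiv.coe_coe,
    LinearEquiv.symm_apply_apply]
  rw [subRep_apply]
  change ρ (g * x * g⁻¹) (ρ g u) = ρ g (ρ x u)
  rw [← rho_mul_apply, ← rho_mul_apply]
  simp

theorem isImprimitivityProj_isoProj (hN : N.Normal) (hσ : IrrOn σ ⊤ ⊤)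
    (hT : ∀ g : G, g ∈ T ↔ ∀ x : N,
      σ.character ⟨g * x * g⁻¹, hN.conj_mem x x.2 g⟩ = σ.character x) :
    IsImprimitivityProj ρ T (isoProj ρ N σ.character) where
  idem := by
    suffices ∀ v ∈ (⊤ : Submodule ℂ V), isoProj ρ N σ.character (isoProj ρ N σ.character v) =
      isoProj ρ N σ.character v from fun v => this v Submodule.mem_top
    refine (invOn_top (ρ := ρ) (M := N)).induction (W := ⊤) (P := fun U => ∀ v ∈ U,
      isoProj ρ N σ.character (isoProj ρ N σ.character v) = isoProj ρ N σ.character v)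
      (by simp) (fun A B hA _ _ _ _ ih v hv => ?_) le_rfl
    obtain ⟨a, ha, b, hb, rfl⟩ := Submodule.mem_sup.1 hv
    rw [map_add, map_add, ih b hb, hA.isoProj_apply hσ a ha]
    split_ifs with h
    · rw [hA.isoProj_apply hσ a ha, if_pos h]
    · rw [map_zero]
  equivariant g hg v := isoProj_rho hN ((hT g).1 hg) v
  disjoint g hg := by
    suffices ∀ v ∈ (⊤ : Submodule ℂ V), isoProj ρ N σ.character
      (ρ g (isoProj ρ N σ.character v)) = 0 from fun v => this v Submodule.mem_top
    refine (invOn_top (ρ := ρ) (M := N)).induction (W := ⊤) (P := fun U => ∀ v ∈ U,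
      isoProj ρ N σ.character (ρ g (isoProj ρ N σ.character v)) = 0)
      (by simp) (fun A B hA _ _ _ _ ih v hv => ?_) le_rfl
    obtain ⟨a, ha, b, hb, rfl⟩ := Submodule.mem_sup.1 hv
    rw [map_add, map_add, map_add, ih b hb, hA.isoProj_apply hσ a ha]
    split_ifs with h
    · have hgA : IrrOn ρ N (A.map (ρ g)) := hA.translate
        (fun m hm => by simpa using hN.conj_mem m hm g⁻¹) (fun m hm => hN.conj_mem m hm g)
      rw [hgA.isoProj_apply hσ _ ⟨a, ha, rfl⟩, if_neg, zero_add]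
      intro h'
      refine hg ((hT g).2 fun x => ?_)
      rw [← h', character_translate hN hA.1, h, h']
    · simp

end IsotypicProjection

section Isotypic

open Representation

variable {G : Type} [Group G] [Finite G] {V : Type} [AddCommGroup V] [Module ℂ V]
  [FiniteDimensional ℂ V] {ρ : Representation ℂ G V} {X : Subgroup G}
  {B : Type} [AddCommGroup B] [Module ℂ B] [FiniteDimensional ℂ B] {σ : Representation ℂ X B}

theorem exists_pi_equiv (hσ : IrrOn σ ⊤ ⊤)
    (h : ∀ A, ∀ hA : IrrOn ρ X A, (subRep ρ X A hA.1).character = σ.character) :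
    ∃ (k : ℕ) (E : V ≃ₗ[ℂ] (Fin k → B)), ∀ x : X, ∀ v i, E (ρ x v) i = σ x (E v i) := by
  have : Fintype X := Fintype.ofFinite X
  suffices ∃ (k : ℕ) (F : (Fin k → B) →ₗ[ℂ] V), Function.Injective F ∧ LinearMap.range F = ⊤ ∧
      ∀ x : X, ∀ v, F (fun i => σ x (v i)) = ρ x (F v) by
    obtain ⟨k, F, hinj, hrange, hF⟩ := this
    let E := LinearEquiv.ofBijective F ⟨hinj, LinearMap.range_eq_top.1 hrange⟩
    refine ⟨k, E.symm, fun x v => ?_⟩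
    obtain ⟨w, rfl⟩ := E.surjective v
    have hx : E (fun i => σ x (w i)) = ρ x (E w) := hF x w
    intro i
    rw [← hx, LinearEquiv.symm_apply_apply, LinearEquiv.symm_apply_apply]
  refine (invOn_top (ρ := ρ) (M := X)).induction (W := ⊤) (P := fun U =>
    ∃ (k : ℕ) (F : (Fin k → B) →ₗ[ℂ] V), Function.Injective F ∧ LinearMap.range F = U ∧
      ∀ x : X, ∀ v, F (fun i => σ x (v i)) = ρ x (F v)) ?_ ?_ le_rfl
  · refine ⟨0, 0, fun _ _ _ => Subsingleton.elim _ _, LinearMap.range_zero, by simp⟩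
  · rintro A C hA - - - hdisj ⟨k, F, hinj, hrange, hF⟩
    have hA' := (subRep_irrOn_top hA.1).2 hA
    obtain ⟨f, hf⟩ : ∃ f : IntertwiningMap σ (subRep ρ X A hA.1), f ≠ 0 := by
      refine exists_intertwining_ne_zero ?_
      rw [hσ.sum_character_mul hA', if_pos (h A hA).symm]
      exact Nat.cast_ne_zero.2 Nat.card_pos.ne'
    have hfi := hσ.intertwining_injective f hf
    have hfs := hA'.intertwining_surjective f hf
    let f' : B →ₗ[ℂ] V := A.subtype ∘ₗ f.toLinearMap
    have hf'i : Function.Injective f' := A.subtype_injective.comp hfi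
    have hf'A : ∀ b, f' b ∈ A := fun b => (f.toLinearMap b).2
    refine ⟨k + 1, f' ∘ₗ LinearMap.proj 0 + F ∘ₗ LinearMap.funLeft ℂ B Fin.succ, ?_, ?_, ?_⟩
    · rw [← LinearMap.ker_eq_bot, LinearMap.ker_eq_bot']
      intro v hv
      have hv' : f' (v 0) + F (fun i => v i.succ) = 0 := hv
      have hC : F (fun i => v i.succ) ∈ C := hrange ▸ LinearMap.mem_range_self _ _
      have h0 : f' (v 0) = 0 := by
        refine (Submodule.disjoint_def.1 hdisj) _ (hf'A _) ?_
        rw [eq_neg_of_add_eq_zero_left hv']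
        exact C.neg_mem hC
      rw [h0, zero_add] at hv'
      have h1 := hf'i (h0.trans (map_zero f').symm)
      have h2 := hinj (hv'.trans (map_zero F).symm)
      funext i
      refine Fin.cases h1 (fun j => congrFun h2 j) i
    · refine le_antisymm ?_ (sup_le ?_ ?_)
      · rintro _ ⟨v, rfl⟩
        exact Submodule.add_mem_sup (hf'A _) (hrange ▸ LinearMap.mem_range_self _ _)
      · intro a ha
        obtain ⟨b, hb⟩ := hfs ⟨a, ha⟩
        refine ⟨Fin.cons b 0, ?_⟩
        have : F (LinearMap.funLeft ℂ B Fin.succ (Fin.cons b 0 : Fin (k + 1) → B)) = 0 := by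
          rw [show LinearMap.funLeft ℂ B Fin.succ (Fin.cons b 0 : Fin (k + 1) → B) = 0 by
            ext i; simp [LinearMap.funLeft_apply], map_zero]
        simp only [LinearMap.add_apply, LinearMap.comp_apply, this, add_zero]
        exact congrArg Subtype.val hb
      · rw [← hrange]
        rintro _ ⟨w, rfl⟩
        refine ⟨Fin.cons 0 w, ?_⟩
        have : LinearMap.funLeft ℂ B Fin.succ (Fin.cons 0 w : Fin (k + 1) → B) = w := by
          ext i; simp [LinearMap.funLeft_apply]
        simp [this]
    · intro x v
      have h1 : f' (σ x (v 0)) = ρ x (f' (v 0)) :=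
        congrArg Subtype.val (intertwining_apply f x (v 0))
      have h2 := hF x (fun i => v i.succ)
      change f' (σ x (v 0)) + F (fun i => σ x (v i.succ)) = ρ x (f' (v 0) + F fun i => v i.succ)
      rw [h1, h2, map_add]

/-- Complex matrices acting on tuples of vectors. -/
def matrixEnd (k : ℕ) (B : Type) [AddCommGroup B] [Module ℂ B] :
    Matrix (Fin k) (Fin k) ℂ →ₐ[ℂ] Module.End ℂ (Fin k → B) where
  toFun b :=
    { toFun := fun v i => ∑ j, b i j • v j
      map_add' := fun v w => by ext; simp [Finset.sum_add_distrib]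
      map_smul' := fun c v => by ext; simp [Finset.smul_sum, smul_comm c] }
  map_one' := by ext v i; simp [Matrix.one_apply]
  map_mul' a b := by
    refine LinearMap.ext fun v => funext fun i => ?_
    simp only [LinearMap.coe_mk, AddHom.coe_mk, Module.End.mul_apply, Matrix.mul_apply,
      Finset.sum_smul, Finset.smul_sum, mul_smul]
    exact Finset.sum_comm
  map_zero' := by ext; simp
  map_add' a b := by
    refine LinearMap.ext fun v => funext fun i => ?_
    simp [add_smul, Finset.sum_add_distrib]
  commutes' c := by
    refine LinearMap.ext fun v => funext fun i => ?_
    simp [Matrix.algebraMap_matrix_apply, ite_smul]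

omit [FiniteDimensional ℂ B] in
theorem matrixEnd_apply {k : ℕ} (b : Matrix (Fin k) (Fin k) ℂ) (v : Fin k → B) (i : Fin k) :
    matrixEnd k B b v i = ∑ j, b i j • v j := rfl

omit [FiniteDimensional ℂ B] in
theorem matrixEnd_injective (k : ℕ) [Nontrivial B] : Function.Injective (matrixEnd k B) := by
  obtain ⟨x, hx⟩ := exists_ne (0 : B)
  intro a b hab
  ext i j
  have := congrFun (LinearMap.congr_fun hab (Pi.single j x)) i
  simp only [matrixEnd_apply, Pi.single_apply, smul_ite, smul_zero, Finset.sum_ite_eq',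
    Finset.mem_univ, if_true] at this
  exact smul_left_injective ℂ hx this

theorem IrrOn.exists_matrixEnd {H : Type} [Group H] {σ : Representation ℂ H B}
    (hσ : IrrOn σ ⊤ ⊤) {k : ℕ} (p : Module.End ℂ (Fin k → B))
    (hp : ∀ x v, p (fun i => σ x (v i)) = fun i => σ x (p v i)) : ∃ b, matrixEnd k B b = p := by
  have hent : ∀ i j, ∃ c : ℂ, ∀ x, p (Pi.single j x) i = c • x := fun i j => by
    obtain ⟨c, hc⟩ := hσ.exists_scalar
      (p := LinearMap.proj i ∘ₗ p ∘ₗ LinearMap.single ℂ (fun _ => B) j) (fun g _ x => by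
        have h1 := congrFun (hp g (Pi.single j x)) i
        have h2 : (fun i => σ g ((Pi.single j x : Fin k → B) i)) = Pi.single j (σ g x) := by
          ext l
          by_cases h : l = j
          · subst h; simp
          · simp [h]
        rw [h2] at h1
        exact h1) fun _ _ => Submodule.mem_top
    exact ⟨c, fun x => hc x Submodule.mem_top⟩
  choose c hc using hent
  refine ⟨Matrix.of c, LinearMap.pi_ext fun j x => funext fun i => ?_⟩
  rw [hc, matrixEnd_apply]
  simp [Pi.single_apply, smul_ite]

/-- If the restriction of an irreducible representation `V` to a normal subgroup is isotypic, then
its multiplicity divides the index. -/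
theorem IrrOn.dvd_index_of_pi_equiv (hV : IrrOn ρ ⊤ ⊤) (hX : X.Normal) (hσ : IrrOn σ ⊤ ⊤)
    {k : ℕ} (hk : k ≠ 0) (E : V ≃ₗ[ℂ] (Fin k → B))
    (hE : ∀ x : X, ∀ v i, E (ρ x v) i = σ x (E v i)) : k ∣ X.index := by
  have : NeZero k := ⟨hk⟩
  have : Nontrivial B := by
    by_contra hB
    rw [not_nontrivial_iff_subsingleton] at hB
    exact hσ.2.1 (Subsingleton.elim _ _)
  let Φ : Matrix (Fin k) (Fin k) ℂ →ₐ[ℂ] Module.End ℂ V :=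
    (E.symm.conjAlgEquiv ℂ : _ →ₐ[ℂ] _).comp (matrixEnd k B)
  have hΦE : ∀ b v, E (Φ b v) = matrixEnd k B b (E v) := fun b v => by
    simp [Φ, LinearEquiv.conjAlgEquiv_apply]
  have hΦ : Function.Injective Φ := (E.symm.conjAlgEquiv ℂ).injective.comp (matrixEnd_injective k)
  have hΦeq : ∀ b, EquivariantOn ρ X (Φ b) := fun b x hx v => by
    apply E.injective
    ext i
    rw [hΦE, matrixEnd_apply, hE ⟨x, hx⟩, hΦE, matrixEnd_apply, map_sum]
    refine Finset.sum_congr rfl fun j _ => ?_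
    rw [hE ⟨x, hx⟩, map_smul]
  have hΦsurj : ∀ p : Module.End ℂ V, EquivariantOn ρ X p → ∃ b, Φ b = p := fun p hp => by
    obtain ⟨b, hb⟩ := hσ.exists_matrixEnd (E.conjAlgEquiv ℂ p) (fun x v => by
      obtain ⟨w, rfl⟩ := E.surjective v
      have : (fun i => σ x (E w i)) = E (ρ x w) := funext fun i => (hE x w i).symm
      rw [this]
      ext i
      simp [LinearEquiv.conjAlgEquiv_apply, hp x x.2, hE])
    refine ⟨b, LinearMap.ext fun v => E.injective ?_⟩
    rw [hΦE, hb]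
    simp [LinearEquiv.conjAlgEquiv_apply]
  have hconj : ∀ (g : G) (p : Module.End ℂ V), EquivariantOn ρ X p →
      EquivariantOn ρ X (ρ g * p * ρ g⁻¹) := fun g p hp x hx v => by
    have h1 : ρ g⁻¹ (ρ x v) = ρ (g⁻¹ * x * g) (ρ g⁻¹ v) := by
      rw [← rho_mul_apply, ← rho_mul_apply]; simp
    have h2 : g⁻¹ * x * g ∈ X := by simpa using hX.conj_mem x hx g⁻¹
    simp only [Module.End.mul_apply]
    rw [h1, hp _ h2, ← rho_mul_apply, ← rho_mul_apply]
    simp [mul_assoc]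
  choose c hc using fun (g : G) b => hΦsurj _ (hconj g _ (hΦeq b))
  have hinv : ∀ g : G, ρ g⁻¹ * ρ g = 1 := fun g => by rw [← map_mul]; simp
  have hinv' : ∀ g : G, ρ g * ρ g⁻¹ = 1 := fun g => by rw [← map_mul]; simp
  have hcmul : ∀ g h b, c (g * h) b = c g (c h b) := fun g h b => hΦ <| by
    rw [hc, hc, hc, mul_inv_rev, map_mul, map_mul]
    simp only [mul_assoc]
  have hcX : ∀ x ∈ X, ∀ b, c x b = b := fun x hx b => hΦ <| by
    rw [hc]
    ext v
    simp only [Module.End.mul_apply]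
    rw [← hΦeq b x hx, rho_apply_inv_apply]
  have hcX' : ∀ g, ∀ x ∈ X, ∀ b, c (g * x) b = c g b := fun g x hx b => by rw [hcmul, hcX x hx]
  have hc1 : ∀ b, c 1 b = b := hcX 1 X.one_mem
  let φ : G → (Matrix (Fin k) (Fin k) ℂ ≃ₐ[ℂ] Matrix (Fin k) (Fin k) ℂ) := fun g =>
    { toFun := c g
      invFun := c g⁻¹
      left_inv := fun b => by rw [← hcmul, inv_mul_cancel, hc1]
      right_inv := fun b => by rw [← hcmul, mul_inv_cancel, hc1]
      map_mul' := fun a b => hΦ <| by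
        rw [hc, map_mul, map_mul, hc, hc]
        calc ρ g * (Φ a * Φ b) * ρ g⁻¹ = ρ g * Φ a * 1 * Φ b * ρ g⁻¹ := by
              simp only [mul_assoc, one_mul]
          _ = _ := by rw [← hinv g]; simp only [mul_assoc]
      map_add' := fun a b => hΦ <| by
        rw [hc, map_add, map_add, hc, hc, mul_add, add_mul]
      commutes' := fun r => hΦ <| by
        rw [hc, AlgHom.commutes, ← Algebra.commutes, mul_assoc, hinv', mul_one] }
  have : Fintype (G ⧸ X) := Fintype.ofFinite _
  rw [Subgroup.index_eq_card, Nat.card_eq_fintype_card]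
  refine Matrix.dvd_card_of_fixedPoints_scalar (fun q : G ⧸ X => φ q.out) (fun q q' b => ?_)
    fun b hb => ?_
  · have hm : (q.out * q'.out)⁻¹ * (q * q').out ∈ X := by
      rw [← QuotientGroup.eq]
      simp
    change c _ b = c _ (c _ b)
    rw [← hcmul, ← hcX' (q.out * q'.out) _ hm b, mul_inv_cancel_left]
  · obtain ⟨z, hz⟩ := hV.exists_scalar (p := Φ b) (fun g _ v => by
      have hm : (QuotientGroup.mk g : G ⧸ X).out⁻¹ * g ∈ X := by
        rw [← QuotientGroup.eq]; simp
      have hcg : c g b = b := by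
        have h1 := hb (QuotientGroup.mk g)
        change c _ b = b at h1
        rwa [← hcX' _ _ hm b, mul_inv_cancel_left] at h1
      have h2 := LinearMap.congr_fun (hc g b) (ρ g v)
      rw [hcg] at h2
      simpa only [Module.End.mul_apply, rho_inv_apply_apply] using h2) fun _ _ => Submodule.mem_top
    refine ⟨z, hΦ ?_⟩
    ext v
    rw [hz v Submodule.mem_top, map_smul, map_one]
    simp

/-- If `V` is irreducible and its dimension is coprime to the index of the normal subgroup `X`, then
`V` is irreducible as a representation of `X`. -/
theorem IrrOn.of_coprime_index (hV : IrrOn ρ ⊤ ⊤) (hX : X.Normal)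
    (hcop : (Module.finrank ℂ V).Coprime X.index) : IrrOn ρ X ⊤ := by
  obtain ⟨A, -, hA⟩ := (invOn_top (ρ := ρ) (M := X)).exists_irrOn hV.2.1
  have hσ := (subRep_irrOn_top hA.1).2 hA
  set σ := subRep ρ X A hA.1 with hσdef
  let T : Subgroup G :=
    { carrier := {g | ∀ x : X, σ.character ⟨g * x * g⁻¹, hX.conj_mem x x.2 g⟩ = σ.character x}
      one_mem' := fun x => by simp
      mul_mem' := fun {g h} hg hh x => by
        rw [← hh x, ← hg ⟨h * x * h⁻¹, hX.conj_mem x x.2 h⟩]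
        congr 2
        simp [mul_assoc]
      inv_mem' := fun {g} hg x => by
        rw [← hg]
        congr 2
        simp [mul_assoc] }
  have he : IsImprimitivityProj ρ T (isoProj ρ X σ.character) :=
    isImprimitivityProj_isoProj hX hσ fun _ => Iff.rfl
  have hXT : X ≤ T := fun g hg x => by
    rw [← char_conj (ρ := σ) x ⟨g, hg⟩]
    rfl
  have hAW : A ≤ LinearMap.range (isoProj ρ X σ.character) := fun a ha =>
    ⟨a, by rw [hA.isoProj_apply hσ a ha, if_pos rfl]⟩
  have hWne : LinearMap.range (isoProj ρ X σ.character) ≠ ⊥ := fun h =>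
    hA.2.1 (eq_bot_iff.2 (h ▸ hAW))
  have hdim := he.finrank_translates (L := ⊤)
    (U := LinearMap.range (isoProj ρ X σ.character)) le_rfl
    (by simpa using he.invOn_range)
  rw [hV.translates_eq le_top hWne, Subgroup.relIndex_top_right, finrank_top] at hdim
  have hT : T = ⊤ := by
    rw [← Subgroup.index_eq_one]
    refine Nat.eq_one_of_dvd_coprimes hcop ⟨_, hdim⟩ (Subgroup.index_dvd_of_le hXT)
  have hW : LinearMap.range (isoProj ρ X σ.character) = ⊤ :=
    hV.2.2 _ le_top (hT ▸ he.invOn_range) hWne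
  obtain ⟨k, E, hE⟩ := exists_pi_equiv (ρ := ρ) hσ fun A' hA' => by
    by_contra hne
    refine hA'.2.1 (eq_bot_iff.2 fun a ha => ?_)
    have h1 := he.apply_of_le_range hW.ge (u := a) Submodule.mem_top
    rw [hA'.isoProj_apply hσ a ha, if_neg hne] at h1
    exact h1.symm
  have hrank : Module.finrank ℂ V = k * Module.finrank ℂ A := by
    rw [E.finrank_eq, Module.finrank_pi_fintype]; simp
  have hVne := hV.finrank_ne_zero
  rw [finrank_top] at hVne
  have hk : k ≠ 0 := fun h0 => hVne (by rw [hrank, h0]; simp)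
  have hk1 : k = 1 := Nat.eq_one_of_dvd_coprimes hcop ⟨_, hrank⟩
    (hV.dvd_index_of_pi_equiv hX hσ hk E hE)
  rw [hk1, one_mul] at hrank
  rwa [← Submodule.eq_top_of_finrank_eq hrank.symm]

theorem IrrOn.of_coprime_relIndex {M : Subgroup G} {Y : Submodule ℂ V} (hX : NormalIn X M)
    (hY : IrrOn ρ M Y) (hcop : (Module.finrank ℂ Y).Coprime (X.relIndex M)) : IrrOn ρ X Y := by
  have h := ((subRep_irrOn_top hY.1).2 hY).of_coprime_index hX.subgroupOf_normal hcop
  rwa [subRep_irrOn_iff, Submodule.map_subtype_top, Subgroup.map_subgroupOf_eq_of_le hX.1] at h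

end Isotypic

section DeterminantalOrders

variable {G : Type} [Group G] [Finite G] {V : Type} [AddCommGroup V] [Module ℂ V]
  [FiniteDimensional ℂ V] {ρ : Representation ℂ G V} {π : Set ℕ} {M H K L T N : Subgroup G}
  {U W : Submodule ℂ V} {e : V →ₗ[ℂ] V}

/-- The determinants of the subnormal subgroups of `K` on their invariant subspaces of `W` are roots
of unity of `π`-order. -/
def PiDet (ρ : Representation ℂ G V) (π : Set ℕ) (K : Subgroup G) (W : Submodule ℂ V) : Prop :=
  ∀ M, SubnormalIn M K → ∀ U ≤ W, InvOn ρ M U → ∀ m ∈ M, IsPiRoot π (detOn (ρ m) U)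

theorem InvOn.isPiRoot_detOn (hW : ∀ U ≤ W, IrrOn ρ M U → ∀ m ∈ M, IsPiRoot π (detOn (ρ m) U))
    (hU : InvOn ρ M U) (hUW : U ≤ W) {m : G} (hm : m ∈ M) : IsPiRoot π (detOn (ρ m) U) := by
  refine hU.induction (P := fun U => IsPiRoot π (detOn (ρ m) U)) ?_ ?_ hUW
  · rw [detOn_bot]
    exact isPiRoot_one π
  · intro A B hA hAW hB _ hdisj hPB
    rw [detOn_sup (hA.1 m hm) (hB m hm) hdisj]
    exact (hW A hAW hA m hm).mul hPB

theorem SubnormalIn.isPiNumber_finrank (h : SubnormalIn M K) (hW : InvOn ρ K W)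
    (hdim : ∀ U ≤ W, IrrOn ρ K U → IsPiNumber π (Module.finrank ℂ U)) :
    ∀ U ≤ W, IrrOn ρ M U → IsPiNumber π (Module.finrank ℂ U) := by
  induction h with
  | refl => exact hdim
  | step h h' ih =>
    intro U hUW hU
    obtain ⟨Y, hYW, hY, p, hp, hpY, hinj⟩ :=
      hU.exists_irrOn_over h.1 (hW.mono h'.le) hUW
    rw [← finrank_map_of_injOn hinj]
    exact (ih hW hdim Y hYW hY).of_dvd
      (hY.finrank_dvd h.2 (hU.map (hp.mono h.1) hinj) hpY)

omit [Finite G] [FiniteDimensional ℂ V] in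
theorem PiDet.of_isPiNumber (hKL : NormalIn K L) (hπ : IsPiNumber π (K.relIndex L))
    (hne : K.relIndex L ≠ 0) (hK : PiDet ρ π (T ⊓ K) W) : PiDet ρ π (T ⊓ L) W := by
  intro M hM U hUW hU m hm
  have hmL : m ∈ L := (hM.le hm).2
  have hpow : ∀ n : ℕ, detOn (ρ (m ^ n)) U = detOn (ρ m) U ^ n := fun n => by
    induction n with
    | zero => simpa using detOn_one U
    | succ n ih =>
      rw [pow_succ, map_mul, detOn_mul (hU _ (M.pow_mem hm n)) (hU m hm), ih, pow_succ]
  have hmK : m ^ K.relIndex L ∈ K := by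
    have := hKL.subgroupOf_normal
    exact Subgroup.pow_index_mem (K.subgroupOf L) ⟨m, hmL⟩
  have hSN : SubnormalIn (M ⊓ K) (T ⊓ K) := by
    have := hM.inf K
    rwa [inf_assoc, inf_eq_right.2 hKL.1] at this
  refine IsPiRoot.of_pow hne hπ ?_
  rw [← hpow]
  exact hK _ hSN U hUW (hU.mono inf_le_left) _ ⟨M.pow_mem hm _, hmK⟩

theorem IsImprimitivityProj.isPiRoot_detOn (he : IsImprimitivityProj ρ T e) (h2 : 2 ∈ π)
    (hKL : NormalIn K L) (hπ : IsPiNumber πᶜ (K.relIndex L))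
    (hU : U ≤ LinearMap.range e) (hinv : InvOn ρ (T ⊓ L) U)
    (hdim : IsPiNumber π (T.relIndex L))
    (hdet : ∀ h ∈ L, IsPiRoot π (detOn (ρ h) (translates ρ L U)))
    (hK : ∀ x ∈ T ⊓ K, IsPiRoot π (detOn (ρ x) U)) :
    ∀ h ∈ T ⊓ L, IsPiRoot π (detOn (ρ h) U) := by
  rintro h ⟨hhT, hhL⟩
  have := hKL.subgroupOf_normal
  have htop : K.subgroupOf L ⊔ T.subgroupOf L = ⊤ := by
    rw [← Subgroup.index_eq_one]
    exact Nat.eq_one_of_dvd_coprimes (hdim.coprime hπ)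
      (Subgroup.index_dvd_of_le le_sup_right) (Subgroup.index_dvd_of_le le_sup_left)
  have hrep : ∀ q : L ⧸ T.subgroupOf L, ∃ k : L, (k : G) ∈ K ∧ (k : L ⧸ T.subgroupOf L) = q := by
    intro q
    induction q using QuotientGroup.induction_on with
    | H g =>
      have hg : g ∈ K.subgroupOf L ⊔ T.subgroupOf L := htop ▸ Subgroup.mem_top g
      rw [← SetLike.mem_coe, Subgroup.normal_mul] at hg
      obtain ⟨k, hk, s, hs, rfl⟩ := hg
      exact ⟨k, hk, QuotientGroup.eq.2 (by simpa using hs)⟩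
  choose r hrK hr using hrep
  obtain ⟨δ, hδ, hprod⟩ := he.detOn_translates hU hinv r hr ⟨h, hhL⟩
  have hδ' : IsPiRoot π δ := ⟨2, two_ne_zero, fun q hq hq2 =>
    (Nat.prime_dvd_prime_iff_eq hq Nat.prime_two).1 hq2 ▸ h2, hδ⟩
  have : Fintype (L ⧸ T.subgroupOf L) := Fintype.ofFinite _
  have hroot := hdet h hhL
  rw [show detOn (ρ h) (translates ρ L U) = _ from hprod, finprod_eq_prod_of_fintype] at hroot
  have hx : ∀ q, h⁻¹ * ((r ((⟨h, hhL⟩ : L) • q) : G)⁻¹ * h * r q) ∈ T ⊓ K := by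
    intro q
    refine ⟨T.mul_mem (T.inv_mem hhT) ?_, ?_⟩
    · have : (r ((⟨h, hhL⟩ : L) • q))⁻¹ * (⟨h, hhL⟩ * r q) ∈ T.subgroupOf L := by
        rw [← QuotientGroup.eq, hr]
        conv_lhs => rw [← hr q]
        rfl
      rw [mul_assoc]
      exact this
    · have := K.mul_mem (hKL.inv_mul_mul hhL (K.inv_mem (hrK ((⟨h, hhL⟩ : L) • q)))) (hrK q)
      simpa [mul_assoc] using this
  have hsplit : ∀ q, detOn (ρ ((r ((⟨h, hhL⟩ : L) • q) : G)⁻¹ * h * r q)) U =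
      detOn (ρ h) U * detOn (ρ (h⁻¹ * ((r ((⟨h, hhL⟩ : L) • q) : G)⁻¹ * h * r q))) U := by
    intro q
    rw [← detOn_mul (hinv h ⟨hhT, hhL⟩) (hinv _ ⟨(hx q).1, hKL.1 (hx q).2⟩), ← map_mul,
      mul_inv_cancel_left]
  simp only [hsplit, Finset.prod_mul_distrib, Finset.prod_const, Finset.card_univ] at hroot
  rw [mul_comm] at hroot
  have hroot' := IsPiRoot.of_mul_right (IsPiRoot.prod Finset.univ _ fun q _ => hK _ (hx q))
    (IsPiRoot.of_mul_right hδ' hroot)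
  refine hroot'.of_pow Fintype.card_ne_zero ?_
  rwa [← Nat.card_eq_fintype_card]

theorem IsImprimitivityProj.piDet (he : IsImprimitivityProj ρ T e) (h2 : 2 ∈ π)
    (hG : IsPiSeparable π G) (hN : N.Normal) (hNT : N ≤ T)
    (heN : ∀ U, InvOn ρ N U → ∀ u ∈ U, e u ∈ U) (hV : IrrOn ρ ⊤ ⊤)
    (hdim : IsPiNumber π (Module.finrank ℂ V)) (hdet : PiDet ρ π ⊤ ⊤) :
    PiDet ρ π T (LinearMap.range e) := by
  have hdimT : ∀ U ≤ LinearMap.range e, IrrOn ρ T U → IsPiNumber π (Module.finrank ℂ U) := by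
    intro U hUW hU
    have h := he.finrank_translates (L := ⊤) hUW (by simpa using hU.1)
    rw [hV.translates_eq le_top hU.2.1, finrank_top] at h
    exact hdim.of_dvd ⟨_, h.trans (mul_comm _ _)⟩
  have hdimV : ∀ U ≤ (⊤ : Submodule ℂ V), IrrOn ρ ⊤ U → IsPiNumber π (Module.finrank ℂ U) := by
    intro U _ hU
    rwa [hV.2.2 U le_top hU.1 hU.2.1, finrank_top]
  suffices PiDet ρ π (T ⊓ ⊤) (LinearMap.range e) by rwa [inf_top_eq] at this
  refine hG.induction N (P := fun K => PiDet ρ π (T ⊓ K) (LinearMap.range e)) ?_ ?_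
  · intro M hM U _ hU
    rw [inf_eq_right.2 hNT] at hM
    refine hdet M (hM.trans (NormalIn.subnormalIn ⟨le_top, fun g _ m hm => ?_⟩)) U le_top hU
    exact hN.conj_mem m hm g
  · rintro K L hNK hKL hL (hπ | hπ) hK
    · exact PiDet.of_isPiNumber hKL hπ Subgroup.index_ne_zero_of_finite hK
    · have hTL : SubnormalIn (T ⊓ L) T := by
        have := hL.inf T
        rwa [top_inf_eq, inf_comm] at this
      have hSN : ∀ {M}, SubnormalIn M (T ⊓ L) → SubnormalIn (M ⊓ K) (T ⊓ K) := by
        intro M hM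
        have := hM.inf K
        rwa [inf_assoc, inf_eq_right.2 hKL.1] at this
      suffices ∀ M, SubnormalIn M (T ⊓ L) → ∀ U ≤ LinearMap.range e, IrrOn ρ M U →
          ∀ m ∈ M, IsPiRoot π (detOn (ρ m) U) from
        fun M hM U hUW hU m hm => hU.isPiRoot_detOn (this M hM) hUW hm
      intro M hM
      generalize hH : T ⊓ L = H at hM
      induction hM with
      | refl =>
        subst hH
        intro U hUW hU
        have hY := he.irrOn_translates (fun U hU => heN U (hU.mono (hNK.trans hKL.1))) hUW hU
        have hYdim := hL.isPiNumber_finrank invOn_top hdimV _ le_top hY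
        rw [he.finrank_translates hUW hU.1] at hYdim
        refine he.isPiRoot_detOn h2 hKL hπ hUW hU.1 (hYdim.of_dvd (dvd_mul_right _ _))
          (fun h hh => hdet L hL _ le_top hY.1 h hh) fun x hx => ?_
        exact hK _ (.refl _) U hUW (hU.1.mono (inf_le_inf_left T hKL.1)) x hx
      | @step M M' _ h h' ih =>
        intro U hUW hU m hm
        subst hH
        have hM' : SubnormalIn M' T := h'.trans hTL
        obtain ⟨Y, hYW, hY, p, hp, hpY, hinj⟩ :=
          hU.exists_irrOn_over h.1 (he.invOn_range.mono hM'.le) hUW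
        have hYdim := hM'.isPiNumber_finrank he.invOn_range hdimT Y hYW hY
        have hM'L : M' ≤ L := h'.le.trans inf_le_right
        have hX : NormalIn (M' ⊓ K) M' := by
          have := hKL.inf M'
          rwa [inf_comm, inf_comm L, inf_eq_left.2 hM'L] at this
        have hYX : IrrOn ρ (M' ⊓ K) Y := by
          refine hY.of_coprime_relIndex hX (hYdim.coprime (hπ.of_dvd ?_))
          rw [Subgroup.inf_relIndex_left, ← hKL.relIndex_sup hM'L]
          exact ⟨_, (Subgroup.relIndex_mul_relIndex K (M' ⊔ K) L le_sup_right
            (sup_le hM'L hKL.1)).symm⟩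
        have hU' := hU.map (hp.mono h.1) hinj
        rw [← detOn_map_of_injOn hU.1 (hp.mono h.1) hinj hm]
        refine hYX.isPiRoot_detOn (fun g (hg : g ∈ M' ⊓ K) m hm => h.2 g hg.1 m hm) hU' hpY hYdim hm
          (fun x hx => ?_) (ih rfl Y hYW hY m (h.1 hm))
        refine hK _ (hSN (.step h h')) _ (hpY.trans hYW) (hU'.1.mono inf_le_left) _ ⟨?_, ?_⟩
        · exact M.mul_mem (M.inv_mem hm) (h.inv_mul_mul hx.1 hm)
        · have := K.mul_mem (hKL.inv_mul_mul (hM'L (h.1 hm)) (K.inv_mem hx.2)) hx.2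
          simpa [mul_assoc] using this

end DeterminantalOrders

section IrreducibleCharacters

open Representation

variable {G : Type} [Group G] {V : Type} [AddCommGroup V] [Module ℂ V] [FiniteDimensional ℂ V]
  {ρ : Representation ℂ G V} {M : Subgroup G} {U U' : Submodule ℂ V} {A : Type} [AddCommGroup A]
  [Module ℂ A] [FiniteDimensional ℂ A]

theorem isCharacter_character (ρ : Representation ℂ G V) : IsCharacter G ρ.character :=
  ⟨FDRep.of ρ, fun _ => rfl⟩

theorem IsCharacter.exists_representation {χ : G → ℂ} (h : IsCharacter G χ) :
    ∃ (A : Type) (_ : AddCommGroup A) (_ : Module ℂ A) (_ : FiniteDimensional ℂ A)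
      (σ : Representation ℂ G A), σ.character = χ := by
  obtain ⟨W, hW⟩ := h
  exact ⟨W, inferInstance, inferInstance, inferInstance, W.ρ, funext fun g => (hW g).symm⟩

theorem character_eq_zero_iff : ρ.character = 0 ↔ Subsingleton V := by
  constructor
  · intro h
    have := congrFun h 1
    rw [char_one] at this
    exact Module.finrank_zero_iff.1 (Nat.cast_eq_zero.1 this)
  · intro h
    ext g
    rw [character, Subsingleton.elim (ρ g) 0, map_zero]
    rfl

omit [FiniteDimensional ℂ V] in
theorem trace_eq_add_of_isCompl {f : V →ₗ[ℂ] V} (h : IsCompl U U') (hU : ∀ u ∈ U, f u ∈ U)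
    (hU' : ∀ u ∈ U', f u ∈ U') [FiniteDimensional ℂ U] [FiniteDimensional ℂ U'] :
    LinearMap.trace ℂ V f =
      LinearMap.trace ℂ U (f.restrict hU) + LinearMap.trace ℂ U' (f.restrict hU') := by
  rw [← LinearMap.trace_prodMap', ← LinearMap.trace_conj' _ (Submodule.prodEquivOfIsCompl U U' h)]
  congr 1
  ext v
  obtain ⟨u, rfl⟩ := (Submodule.prodEquivOfIsCompl U U' h).surjective v
  simp [LinearEquiv.conj_apply]

variable [Finite G]

theorem IsIrrChar.irrOn (h : IsIrrChar G ρ.character) : IrrOn ρ ⊤ ⊤ := by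
  refine ⟨invOn_top, fun hbot => h.2.1 (character_eq_zero_iff.2 ?_), fun U _ hU hne => ?_⟩
  · exact (Submodule.subsingleton_iff ℂ).1 (subsingleton_of_bot_eq_top hbot.symm)
  · by_contra htop
    obtain ⟨C, -, hC, hdisj, hsup⟩ := invOn_top.exists_compl hU le_top
    have hCne : C ≠ ⊥ := by
      rintro rfl
      exact htop (by simpa using hsup)
    have hchar : ∀ {X : Submodule ℂ V} (hX : InvOn ρ ⊤ X), X ≠ ⊥ →
        IsCharacter G (fun g => (subRep ρ ⊤ X hX).character ⟨g, Subgroup.mem_top g⟩) ∧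
          (fun g => (subRep ρ ⊤ X hX).character ⟨g, Subgroup.mem_top g⟩) ≠ 0 := by
      intro X hX hXne
      let ξ : Representation ℂ G X :=
        (subRep ρ ⊤ X hX).comp (Subgroup.topEquiv (G := G)).symm.toMonoidHom
      refine ⟨isCharacter_character ξ, fun h0 => hXne ?_⟩
      exact (Submodule.subsingleton_iff_eq_bot).1 (character_eq_zero_iff (ρ := ξ).1 h0)
    refine h.2.2 ⟨_, _, (hchar hU hne).1, (hchar hU hne).2, (hchar hC hCne).1,
      (hchar hC hCne).2, ?_⟩
    ext g
    exact trace_eq_add_of_isCompl ⟨hdisj, codisjoint_iff.2 hsup⟩ (hU g (Subgroup.mem_top g))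
      (hC g (Subgroup.mem_top g))

theorem IrrOn.isIrrChar (h : IrrOn ρ ⊤ ⊤) : IsIrrChar G ρ.character := by
  have : Fintype G := Fintype.ofFinite G
  refine ⟨isCharacter_character ρ, fun h0 => h.2.1 ?_, ?_⟩
  · have := character_eq_zero_iff.1 h0
    exact Subsingleton.elim _ _
  rintro ⟨χ₁, χ₂, h₁, hne₁, h₂, hne₂, hχ⟩
  obtain ⟨A₁, _, _, _, σ₁, rfl⟩ := h₁.exists_representation
  obtain ⟨A₂, _, _, _, σ₂, rfl⟩ := h₂.exists_representation
  have hdim : Module.finrank ℂ V = Module.finrank ℂ A₁ + Module.finrank ℂ A₂ := by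
    have := congrFun hχ 1
    rw [Pi.add_apply, char_one, char_one, char_one] at this
    exact_mod_cast this
  have hpos₁ : Module.finrank ℂ A₁ ≠ 0 := fun h0 =>
    hne₁ (character_eq_zero_iff.2 (Module.finrank_zero_iff.1 h0))
  have hpos₂ : Module.finrank ℂ A₂ ≠ 0 := fun h0 =>
    hne₂ (character_eq_zero_iff.2 (Module.finrank_zero_iff.1 h0))
  have hsum := h.sum_character_mul h
  rw [if_pos rfl] at hsum
  conv_lhs at hsum =>
    enter [2, g]
    rw [congrFun hχ g, Pi.add_apply, add_mul]
  rw [Finset.sum_add_distrib] at hsum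
  have hle : ∀ {A : Type} [AddCommGroup A] [Module ℂ A] [FiniteDimensional ℂ A]
      (σ : Representation ℂ G A), ∑ g, σ.character g * ρ.character g⁻¹ ≠ 0 →
      Module.finrank ℂ V ≤ Module.finrank ℂ A := by
    intro A _ _ _ σ hne
    obtain ⟨f, hf⟩ := exists_intertwining_ne_zero hne
    exact LinearMap.finrank_le_finrank_of_injective (h.intertwining_injective f hf)
  by_cases hz : ∑ g, σ₁.character g * ρ.character g⁻¹ = 0
  · rw [hz, zero_add] at hsum
    have := hle σ₂ (by rw [hsum]; exact Nat.cast_ne_zero.2 Nat.card_pos.ne')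
    lia
  · have := hle σ₁ hz
    lia

theorem IrrOn.isConstituent (h : IrrOn ρ M U) :
    IsConstituent (subRep ρ M U h.1).character (resChar M ρ.character) := by
  refine ⟨((subRep_irrOn_top h.1).2 h).isIrrChar, ?_⟩
  obtain ⟨C, -, hC, hdisj, hsup⟩ := (invOn_top (ρ := ρ)).exists_compl h.1 le_top
  refine ⟨_, .inr (isCharacter_character (subRep ρ M C hC)), ?_⟩
  ext m
  exact trace_eq_add_of_isCompl ⟨hdisj, codisjoint_iff.2 hsup⟩ (h.1 m m.2) (hC m m.2)

theorem IsConstituent.exists_intertwining {σ : Representation ℂ G A}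
    (h : IsConstituent σ.character ρ.character) : ∃ f : IntertwiningMap σ ρ, f ≠ 0 := by
  have : Fintype G := Fintype.ofFinite G
  obtain ⟨hirr, ξ, hξ, hsum⟩ := h
  have hσ := hirr.irrOn.sum_character_mul hirr.irrOn
  rw [if_pos rfl] at hσ
  refine exists_intertwining_ne_zero ?_
  have hc : (Nat.card G : ℂ) ≠ 0 := Nat.cast_ne_zero.2 Nat.card_pos.ne'
  rw [hsum]
  simp only [Pi.add_apply, add_mul, Finset.sum_add_distrib, hσ]
  obtain rfl | hξ := hξ
  · simp
  · obtain ⟨B, _, _, _, τ, rfl⟩ := hξ.exists_representation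
    rw [sum_character_mul]
    rw [← mul_one_add]
    refine mul_ne_zero hc ?_
    exact_mod_cast (by lia : 1 + Module.finrank ℂ (IntertwiningMap σ τ) ≠ 0)

omit [FiniteDimensional ℂ V] [FiniteDimensional ℂ A] [Finite G] in
theorem invOn_range_intertwining {σ : Representation ℂ M A}
    (f : IntertwiningMap σ (ρ.comp M.subtype)) : InvOn ρ M (LinearMap.range f.toLinearMap) := by
  rintro m hm _ ⟨a, rfl⟩
  exact ⟨σ ⟨m, hm⟩ a, intertwining_apply f _ _⟩

omit [FiniteDimensional ℂ V] [FiniteDimensional ℂ A] [Finite G] in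
theorem IrrOn.character_range {σ : Representation ℂ M A} (hσ : IrrOn σ ⊤ ⊤)
    (f : IntertwiningMap σ (ρ.comp M.subtype)) (hf : f ≠ 0) :
    (subRep ρ M _ (invOn_range_intertwining f)).character = σ.character := by
  have hinj := hσ.intertwining_injective f hf
  let f' : IntertwiningMap σ (subRep ρ M _ (invOn_range_intertwining f)) :=
    ⟨f.toLinearMap.rangeRestrict, fun m => by
      ext a
      exact intertwining_apply f m a⟩
  refine (character_eq_of_bijective f' ⟨fun a b hab => hinj ?_, ?_⟩).symm
  · exact congrArg Subtype.val hab
  · exact f.toLinearMap.surjective_rangeRestrict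

omit [FiniteDimensional ℂ V] in
theorem IrrOn.irrOn_range {σ : Representation ℂ M A} (hσ : IrrOn σ ⊤ ⊤)
    (f : IntertwiningMap σ (ρ.comp M.subtype)) (hf : f ≠ 0) :
    IrrOn ρ M (LinearMap.range f.toLinearMap) := by
  rw [← subRep_irrOn_top (invOn_range_intertwining f)]
  refine IsIrrChar.irrOn ?_
  rw [hσ.character_range f hf]
  exact hσ.isIrrChar

theorem IsConstituent.exists_irrOn {θ : M → ℂ} (h : IsConstituent θ (resChar M ρ.character)) :
    ∃ (U : Submodule ℂ V) (hU : IrrOn ρ M U), (subRep ρ M U hU.1).character = θ := by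
  obtain ⟨A, _, _, _, σ, rfl⟩ := h.1.1.exists_representation
  obtain ⟨f, hf⟩ := IsConstituent.exists_intertwining (ρ := ρ.comp M.subtype) h
  exact ⟨_, h.1.irrOn.irrOn_range f hf, h.1.irrOn.character_range f hf⟩

end IrreducibleCharacters

section SpecialCharacters

open Representation

variable {G : Type} [Group G] [Finite G] {V : Type} [AddCommGroup V] [Module ℂ V]
  [FiniteDimensional ℂ V] {ρ : Representation ℂ G V} {π : Set ℕ} {M K T : Subgroup G}
  {U W : Submodule ℂ V}

theorem hasPiDetOrder_iff (hρ : IrrOn ρ ⊤ ⊤) :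
    HasPiDetOrder π G ρ.character ↔ ∀ g, IsPiRoot π (LinearMap.det (ρ g)) := by
  have : Fintype G := Fintype.ofFinite G
  constructor
  · rintro ⟨W, hW, hord⟩ g
    have hchar : Representation.character W.ρ = ρ.character := (funext hW).symm
    have hirr : IrrOn (ρ := W.ρ) ⊤ ⊤ := IsIrrChar.irrOn (hchar ▸ hρ.isIrrChar)
    obtain ⟨f, hf⟩ := exists_intertwining_ne_zero (σ := W.ρ) (τ := ρ) (by
      rw [hirr.sum_character_mul hρ, if_pos hchar]
      exact Nat.cast_ne_zero.2 Nat.card_pos.ne')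
    have hdet : LinearMap.det (W.ρ g) = LinearMap.det (ρ g) :=
      det_eq_of_equiv (LinearEquiv.ofBijective f.toLinearMap
        ⟨hirr.intertwining_injective f hf, hρ.intertwining_surjective f hf⟩)
        fun v => intertwining_apply f g v
    have hfin : IsOfFinOrder (fun g : G => LinearMap.det (W.ρ g)) := by
      refine isOfFinOrder_iff_pow_eq_one.2 ⟨Nat.card G, Nat.card_pos, funext fun g => ?_⟩
      rw [Pi.pow_apply, ← map_pow, ← map_pow, pow_card_eq_one', map_one, map_one, Pi.one_apply]
    refine ⟨_, hfin.orderOf_pos.ne', hord, ?_⟩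
    rw [← hdet]
    exact congrFun (pow_orderOf_eq_one fun g : G => LinearMap.det (W.ρ g)) g
  · intro h
    choose n hn0 hn hpow using h
    refine ⟨FDRep.of ρ, fun _ => rfl, IsPiNumber.of_dvd (n := ∏ g, n g) ?_ ?_⟩
    · exact Finset.prod_induction n (IsPiNumber π) (fun _ _ => .mul) (isPiNumber_one π)
        fun g _ => hn g
    · refine orderOf_dvd_of_pow_eq_one (funext fun g => ?_)
      obtain ⟨k, hk⟩ := Finset.dvd_prod_of_mem n (Finset.mem_univ g)
      rw [Pi.pow_apply, hk, pow_mul]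
      exact (congrArg (· ^ k) (hpow g)).trans (one_pow k)

theorem IrrOn.hasPiDetOrder_iff (hU : IrrOn ρ M U) :
    HasPiDetOrder π M (subRep ρ M U hU.1).character ↔ ∀ m ∈ M, IsPiRoot π (detOn (ρ m) U) := by
  rw [_root_.hasPiDetOrder_iff ((subRep_irrOn_top hU.1).2 hU), Subtype.forall]
  refine forall₂_congr fun m hm => ?_
  rw [detOn_eq (hU.1 m hm)]
  rfl

theorem IsPiSpecial.piDet (h : IsPiSpecial π G ρ.character) : PiDet ρ π ⊤ ⊤ := by
  intro M hM U hUW hU m hm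
  refine hU.isPiRoot_detOn (W := ⊤) (fun U _ hU => ?_) hUW hm
  rw [← hU.hasPiDetOrder_iff]
  exact h.2.2 M (isSubnormalSubgroup_iff.2 hM) _ hU.isConstituent

theorem PiDet.isPiSpecial (h : PiDet ρ π ⊤ ⊤) (hρ : IrrOn ρ ⊤ ⊤)
    (hdim : IsPiNumber π (Module.finrank ℂ V)) : IsPiSpecial π G ρ.character := by
  refine ⟨hρ.isIrrChar, ⟨_, char_one ρ, hdim⟩, fun M hM θ hθ => ?_⟩
  obtain ⟨U, hU, rfl⟩ := hθ.exists_irrOn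
  rw [hU.hasPiDetOrder_iff]
  exact h M (isSubnormalSubgroup_iff.1 hM) U le_top hU.1

omit [Finite G] [FiniteDimensional ℂ V] in
theorem PiDet.subRep (h : PiDet ρ π T W) (hU : InvOn ρ T U) (hUW : U ≤ W) :
    PiDet (subRep ρ T U hU) π ⊤ ⊤ := by
  intro M hM U' _ hU' m hm
  have hM' : SubnormalIn (M.map T.subtype) T := by
    have := hM.map T.subtype
    rwa [← MonoidHom.range_eq_map, Subgroup.range_subtype] at this
  have hinv := (subRep_map_subtype_invOn hU).1 hU'
  have hmem : (m : G) ∈ M.map T.subtype := ⟨m, hm, rfl⟩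
  rw [detOn_of_equiv (f' := ρ m)
    (U'.equivMapOfInjective U.subtype U.subtype_injective) (hU' m hm) (hinv m hmem) fun u => rfl]
  exact h _ hM' _ ((Submodule.map_subtype_le U U').trans hUW) hinv _ hmem

omit [Finite G] [FiniteDimensional ℂ V] in
theorem rho_apply_of_finrank_eq_one (h : Module.finrank ℂ V = 1) (g : G) (v : V) :
    ρ g v = ρ.character g • v := by
  have : FiniteDimensional ℂ V := Module.finite_of_finrank_eq_succ h
  obtain ⟨w, hw⟩ := Module.finrank_pos_iff_exists_ne_zero.1
    (h.symm ▸ one_pos : 0 < Module.finrank ℂ V)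
  obtain ⟨c, hc⟩ := exists_smul_eq_of_finrank_eq_one h hw (ρ g w)
  have hρ : ρ g = c • LinearMap.id := by
    ext v
    obtain ⟨a, rfl⟩ := exists_smul_eq_of_finrank_eq_one h hw v
    rw [map_smul, ← hc, LinearMap.smul_apply, LinearMap.id_apply, smul_comm]
  rw [character, hρ, map_smul, LinearMap.trace_id, h]
  simp

omit [Finite G] [FiniteDimensional ℂ V] in
theorem det_of_finrank_eq_one (h : Module.finrank ℂ V = 1) (g : G) :
    LinearMap.det (ρ g) = ρ.character g := by
  have : ρ g = ρ.character g • LinearMap.id := LinearMap.ext (rho_apply_of_finrank_eq_one h g)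
  simpa [h] using congrArg LinearMap.det this

omit [FiniteDimensional ℂ V] in
theorem eq_bot_or_eq_top_of_finrank_eq_one (h : Module.finrank ℂ V = 1) (U : Submodule ℂ V) :
    U = ⊥ ∨ U = ⊤ := by
  have : IsSimpleModule ℂ V := isSimpleModule_iff_finrank_eq_one.2 h
  exact eq_bot_or_eq_top U

omit [Finite G] [FiniteDimensional ℂ V] in
theorem IrrOn.of_finrank_eq_one (h : Module.finrank ℂ V = 1) : IrrOn ρ ⊤ ⊤ := by
  refine ⟨invOn_top, fun hbot => ?_, fun U _ _ hU =>
    (eq_bot_or_eq_top_of_finrank_eq_one h U).resolve_left hU⟩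
  rw [← finrank_top ℂ V, hbot, finrank_bot] at h
  exact zero_ne_one h

omit [Finite G] [FiniteDimensional ℂ V] in
theorem PiDet.of_finrank_eq_one (h : Module.finrank ℂ V = 1)
    (hroot : ∀ g, IsPiRoot π (ρ.character g)) : PiDet ρ π K W := by
  intro M _ U _ _ m _
  obtain rfl | rfl := eq_bot_or_eq_top_of_finrank_eq_one h U
  · rw [detOn_bot]
    exact isPiRoot_one π
  · rw [detOn_top, det_of_finrank_eq_one h]
    exact hroot m

end SpecialCharacters

section Twist

open Representation

variable {G : Type} [Group G] {V : Type} [AddCommGroup V] [Module ℂ V]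
  {ρ : Representation ℂ G V} {c : G →* ℂ} {M T : Subgroup G} {U : Submodule ℂ V} {e : V →ₗ[ℂ] V}

/-- The twist of a representation by a linear character. -/
def twist (c : G →* ℂ) (ρ : Representation ℂ G V) : Representation ℂ G V where
  toFun g := c g • ρ g
  map_one' := by simp
  map_mul' a b := by rw [map_mul, map_mul, smul_mul_smul_comm]

theorem twist_apply (g : G) (v : V) : twist c ρ g v = c g • ρ g v := rfl

theorem linearCharacter_ne_zero (c : G →* ℂ) (g : G) : c g ≠ 0 :=
  ((Group.isUnit g).map c).ne_zero

theorem character_twist (g : G) : (twist c ρ).character g = ρ.character g * c g := by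
  rw [character, character, mul_comm, ← smul_eq_mul, ← map_smul]
  rfl

theorem invOn_twist : InvOn (twist c ρ) M U ↔ InvOn ρ M U :=
  forall₄_congr fun g _ _ _ => U.smul_mem_iff (linearCharacter_ne_zero c g)

theorem irrOn_twist : IrrOn (twist c ρ) M U ↔ IrrOn ρ M U := by
  simp only [IrrOn, invOn_twist]

theorem IsImprimitivityProj.of_twist (he : IsImprimitivityProj (twist c ρ) T e) :
    IsImprimitivityProj ρ T e where
  idem := he.idem
  equivariant g hg v := by
    have := he.equivariant g hg v
    rw [twist_apply, twist_apply, map_smul] at this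
    exact smul_right_injective V (linearCharacter_ne_zero c g) this
  disjoint g hg v := by
    have := he.disjoint g hg v
    rw [twist_apply, map_smul] at this
    exact (smul_eq_zero.1 this).resolve_left (linearCharacter_ne_zero c g)

end Twist

section Induction

variable {G : Type} [Group G] [Fintype G] {T : Subgroup G}

/-- Frobenius reciprocity. -/
theorem sum_mul_indChar {χ : G → ℂ} (hχ : ∀ g h, χ (h * g * h⁻¹) = χ g) (ψ : T → ℂ) :
    Nat.card T * ∑ g, χ g * indChar T ψ g⁻¹ = Nat.card G * ∑ t : T, χ t * ψ t⁻¹ := by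
  have hT : (Nat.card T : ℂ) ≠ 0 := Nat.cast_ne_zero.2 Nat.card_pos.ne'
  let ψ₀ : G → ℂ := fun g => if h : g ∈ T then ψ ⟨g, h⟩ else 0
  have hconj : ∀ x : G, ∑ g, χ g * ψ₀ (x * g⁻¹ * x⁻¹) = ∑ g, χ g * ψ₀ g⁻¹ := by
    intro x
    refine Fintype.sum_equiv (MulAut.conj x).toEquiv _ _ fun g => ?_
    simp only [MulEquiv.toEquiv_eq_coe, MulEquiv.coe_toEquiv, MulAut.conj_apply, hχ]
    simp [mul_assoc]
  have hres : ∑ g, χ g * ψ₀ g⁻¹ = ∑ t : T, χ t * ψ t⁻¹ := by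
    have hzero : ∀ g ∈ Finset.univ, g ∉ Finset.univ.filter (· ∈ T) → χ g * ψ₀ g⁻¹ = 0 := by
      intro g _ hg
      simp only [Finset.mem_filter, Finset.mem_univ, true_and] at hg
      rw [show ψ₀ g⁻¹ = 0 from dif_neg fun h => hg (inv_mem_iff.1 h), mul_zero]
    rw [← Finset.sum_subset (Finset.subset_univ _) hzero,
      Finset.sum_subtype _ (p := (· ∈ T)) (by simp)]
    refine Finset.sum_congr rfl fun t _ => ?_
    rw [show ψ₀ (t : G)⁻¹ = ψ t⁻¹ from dif_pos (T.inv_mem t.2)]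
  have hind : ∀ g, indChar T ψ g = (Nat.card T : ℂ)⁻¹ * ∑ x, ψ₀ (x * g * x⁻¹) := fun g => rfl
  calc Nat.card T * ∑ g, χ g * indChar T ψ g⁻¹
      = ∑ g, ∑ x, χ g * ψ₀ (x * g⁻¹ * x⁻¹) := by
        rw [Finset.mul_sum]
        refine Finset.sum_congr rfl fun g _ => ?_
        rw [hind, mul_left_comm, mul_inv_cancel_left₀ hT, Finset.mul_sum]
    _ = ∑ _x : G, ∑ t : T, χ t * ψ t⁻¹ := by
        rw [Finset.sum_comm]
        exact Finset.sum_congr rfl fun x _ => (hconj x).trans hres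
    _ = Nat.card G * ∑ t : T, χ t * ψ t⁻¹ := by
        rw [Finset.sum_const, Finset.card_univ, nsmul_eq_mul, Nat.card_eq_fintype_card]

end Induction

/-- **Theorem (Statement 14).** Let `π` be a set of primes with `2 ∈ π` and let `G` be a
finite `π`-separable group.  Let `χ ∈ Irr(G)` be `π`-factored with `χ(1)` a `π`-number,
let `N ⊴ G`, let `θ` be an irreducible constituent of `χ_N` and let `T = G_θ`.  Then the
Clifford correspondent `ψ ∈ Irr(T | θ)` of `χ` with respect to `θ` is `π`-factored. -/
theorem clifford_correspondent_factored
    (π : Set ℕ) (h2 : 2 ∈ π)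
    (G : Type) [Group G] [Fintype G] (hG : IsPiSeparable π G)
    (χ : G → ℂ) (hχfac : IsPiFactored π G χ)
    (hdeg : ∃ n : ℕ, χ 1 = (n : ℂ) ∧ IsPiNumber π n)
    (N : Subgroup G) (hN : N.Normal)
    (θ : ↥N → ℂ) (hθ : IsConstituent θ (resChar N χ))
    (T : Subgroup G)
    (hT : ∀ g : G, g ∈ T ↔
      ∀ x : ↥N, θ ⟨g * (x : G) * g⁻¹, hN.conj_mem (x : G) x.2 g⟩ = θ x)
    (hNT : N ≤ T)
    (ψ : ↥T → ℂ) (hψirr : IsIrrChar ↥T ψ)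
    (hψover : IsConstituent θ (resCharLe hNT ψ))
    (hψind : indChar T ψ = χ) :
    IsPiFactored π ↥T ψ := by
  obtain ⟨α, β, hα, hβ, rfl⟩ := hχfac
  obtain ⟨V, _, _, _, ρ, rfl⟩ := hα.1.1.exists_representation
  obtain ⟨B, _, _, _, τ, rfl⟩ := hβ.1.1.exists_representation
  have hρ : IrrOn ρ ⊤ ⊤ := hα.1.irrOn
  obtain ⟨hdimV, hB⟩ : IsPiNumber π (Module.finrank ℂ V) ∧ Module.finrank ℂ B = 1 := by
    obtain ⟨n, hn, hnπ⟩ := hdeg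
    obtain ⟨m, hm, hmπ⟩ := hβ.2.1
    rw [Pi.mul_apply, Representation.char_one, Representation.char_one] at hn
    rw [Representation.char_one] at hm
    have hn' : Module.finrank ℂ V * Module.finrank ℂ B = n := by exact_mod_cast hn
    obtain rfl : Module.finrank ℂ B = m := by exact_mod_cast hm
    exact ⟨hnπ.of_dvd ⟨_, hn'.symm⟩, (Nat.coprime_self _).1
      ((hnπ.of_dvd ⟨_, hn'.symm.trans (mul_comm _ _)⟩).coprime hmπ)⟩
  let c : G →* ℂ := LinearMap.det.comp τ
  have hc : ∀ g, c g = τ.character g := det_of_finrank_eq_one hB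
  have hcroot : ∀ g, IsPiRoot πᶜ (τ.character g) := fun g => by
    rw [← det_of_finrank_eq_one hB, ← detOn_top]
    exact hβ.piDet ⊤ (.refl _) ⊤ le_rfl invOn_top g (Subgroup.mem_top g)
  let ρ' := twist c ρ
  have hχ : ρ'.character = ρ.character * τ.character := funext fun g => by
    rw [character_twist, hc, Pi.mul_apply]
  have hρ' : IrrOn ρ' ⊤ ⊤ := irrOn_twist.2 hρ
  obtain ⟨A, _, _, _, σ, rfl⟩ := hθ.1.1.exists_representation
  have hσ : IrrOn σ ⊤ ⊤ := hθ.1.irrOn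
  obtain ⟨P, _, _, _, Ψ, rfl⟩ := hψirr.1.exists_representation
  have hΨ : IrrOn Ψ ⊤ ⊤ := hψirr.irrOn
  obtain ⟨f, hf⟩ : ∃ f : Representation.IntertwiningMap Ψ (ρ'.comp T.subtype), f ≠ 0 := by
    refine exists_intertwining_ne_zero fun h0 => ?_
    have h := sum_mul_indChar (χ := ρ'.character) (fun g h => ρ'.char_conj g h) Ψ.character
    rw [hψind, ← hχ, hρ'.sum_character_mul hρ', if_pos rfl] at h
    refine mul_ne_zero ?_ ?_ (h.trans (mul_eq_zero_of_right _ h0))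
    all_goals exact Nat.cast_ne_zero.2 Nat.card_pos.ne'
  have hU := hΨ.irrOn_range f hf
  have hUchar := hΨ.character_range f hf
  set U := LinearMap.range f.toLinearMap with hUdef
  set e := isoProj ρ' N σ.character
  have he : IsImprimitivityProj ρ' T e := isImprimitivityProj_isoProj hN hσ hT
  have hUe : U ≤ LinearMap.range e := by
    obtain ⟨g, hg⟩ := IsConstituent.exists_intertwining
      (ρ := Ψ.comp (Subgroup.inclusion hNT)) hψover
    let fg : Representation.IntertwiningMap σ (ρ'.comp N.subtype) :=
      ⟨f.toLinearMap ∘ₗ g.toLinearMap, fun n => by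
        ext a
        simp only [LinearMap.comp_apply]
        rw [intertwining_apply g n a]
        exact intertwining_apply f _ _⟩
    have hfg : fg ≠ 0 := by
      intro h0
      refine hg (Representation.IntertwiningMap.ext (LinearMap.ext fun a => ?_))
      refine hΨ.intertwining_injective f hf ?_
      refine Eq.trans ?_ (map_zero f.toLinearMap).symm
      exact congrArg (fun φ : Representation.IntertwiningMap σ (ρ'.comp N.subtype) => φ a) h0
    have hY := hσ.irrOn_range fg hfg
    have hYchar := hσ.character_range fg hfg
    have hYU : LinearMap.range fg.toLinearMap ≤ U := LinearMap.range_comp_le_range _ _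
    have hYe : LinearMap.range fg.toLinearMap ≤ LinearMap.range e := fun y hy =>
      ⟨y, (hY.isoProj_apply hσ y hy).trans (if_pos hYchar)⟩
    rw [← inf_eq_left]
    exact hU.2.2 _ inf_le_left (hU.1.inf he.invOn_range) fun hbot =>
      hY.2.1 (eq_bot_iff.2 (hbot ▸ le_inf hYU hYe))
  have hUρ : IrrOn ρ T U := irrOn_twist.1 hU
  have heρ : IsImprimitivityProj ρ T e := he.of_twist
  have hdet : PiDet ρ π T (LinearMap.range e) := heρ.piDet h2 hG hN hNT
    (fun X hX => isoProj_mem (invOn_twist.2 hX) σ.character) hρ hdimV hα.piDet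
  have hdimU : IsPiNumber π (Module.finrank ℂ U) := by
    have h := heρ.finrank_translates (L := ⊤) hUe (by simpa using hUρ.1)
    rw [hρ.translates_eq le_top hUρ.2.1, finrank_top] at h
    exact hdimV.of_dvd ⟨_, h.trans (mul_comm _ _)⟩
  have hτ : IsPiSpecial πᶜ T (Representation.character (τ.comp T.subtype)) := by
    refine (PiDet.of_finrank_eq_one (ρ := τ.comp T.subtype) hB fun t => hcroot t).isPiSpecial
      (.of_finrank_eq_one hB) ?_
    rw [hB]
    exact isPiNumber_one _
  refine ⟨(subRep ρ T U hUρ.1).character, Representation.character (τ.comp T.subtype),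
    (hdet.subRep hUρ.1 hUe).isPiSpecial ((subRep_irrOn_top hUρ.1).2 hUρ) hdimU, hτ, ?_⟩
  rw [← hUchar]
  ext t
  have : subRep ρ' T U hU.1 t = c t • subRep ρ T U hUρ.1 t := rfl
  rw [Representation.character, this, map_smul, hc, smul_eq_mul, mul_comm]
  rfl
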